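/- Let q > 1 and γ ∈ W^{1,∞}_{i,a}(𝕋, ℝ^n). Then TP^{(q+1,q)}(γ) ≥ π ∫₀¹ sin(πw)^{q−1} dw, with equality if and only if the image of γ is a round circle. -/

import Mathlib

open MeasureTheory Real Set intervalIntegral
open scoped ENNReal RealInnerProductSpace

noncomputable section

/-- A closed `W^{1,1}`-curve on the torus `𝕋 = ℝ/ℤ` with values in `ℝⁿ`, encoded as a
`1`-periodic absolutely continuous function `toFun : ℝ → ℝⁿ` together with its
(weak) derivative `deriv'`. -/
structure ClosedCurve (n : ℕ) where
  toFun : ℝ → EuclideanSpace ℝ (Fin n)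
  deriv' : ℝ → EuclideanSpace ℝ (Fin n)
  periodic : Function.Periodic toFun 1
  deriv'_periodic : Function.Periodic deriv' 1
  integrableOn : MeasureTheory.IntegrableOn deriv' (Set.Icc (0:ℝ) 1)
  eq_integral : ∀ t : ℝ, toFun t = toFun 0 + ∫ s in (0:ℝ)..t, deriv' s

namespace ClosedCurve

variable {n : ℕ}

/-- Injectivity as a map on the torus `ℝ/ℤ`. -/
def IsInj (γ : ClosedCurve n) : Prop :=
  ∀ s t : ℝ, γ.toFun s = γ.toFun t → ∃ k : ℤ, s - t = (k : ℝ)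

/-- Regularity: the derivative does not vanish a.e. -/
def IsRegular (γ : ClosedCurve n) : Prop := ∀ᵐ t : ℝ ∂volume, γ.deriv' t ≠ 0

/-- Parametrization by arc length: `|γ'| = 1` a.e. -/
def IsArclength (γ : ClosedCurve n) : Prop := ∀ᵐ t : ℝ ∂volume, ‖γ.deriv' t‖ = 1

/-- The length of a closed curve. -/
def length (γ : ClosedCurve n) : ℝ := ∫ t in (0:ℝ)..1, ‖γ.deriv' t‖

end ClosedCurve

/-- Orthogonal projection onto the orthogonal complement of `span {v}` (for `v ≠ 0`). -/
def projPerp {F : Type*} [NormedAddCommGroup F] [InnerProductSpace ℝ F] (v x : F) : F :=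
  x - (⟪v, x⟫ / ‖v‖ ^ 2) • v

/-- The Gauss map `φ_γ(u,w)`: the unit secant direction. -/
def gaussMap {n : ℕ} (γ : ClosedCurve n) (u w : ℝ) : EuclideanSpace ℝ (Fin n) :=
  ‖γ.toFun (u + w) - γ.toFun u‖⁻¹ • (γ.toFun (u + w) - γ.toFun u)

/-- `|∂_u φ_γ(u,w)|`, expressed via the identity (1.8) of the paper. -/
def gaussDerivU {n : ℕ} (γ : ClosedCurve n) (u w : ℝ) : ℝ :=
  ‖projPerp (gaussMap γ u w) (γ.deriv' (u + w) - γ.deriv' u)‖ /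
    ‖γ.toFun (u + w) - γ.toFun u‖

/-- `|∂_w φ_γ(u,w)|`, expressed via the identity (1.7) of the paper. -/
def gaussDerivW {n : ℕ} (γ : ClosedCurve n) (u w : ℝ) : ℝ :=
  ‖projPerp (gaussMap γ u w) (γ.deriv' (u + w))‖ / ‖γ.toFun (u + w) - γ.toFun u‖

/-- The generalized tangent-point energy `TP^{(p,q)}` (with values in `[0,∞]`). -/
def TP {n : ℕ} (p q : ℝ) (γ : ClosedCurve n) : ℝ≥0∞ :=
  ∫⁻ u in Set.Ioc (0:ℝ) 1, ∫⁻ w in Set.Ioc (0:ℝ) 1,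
    ENNReal.ofReal
      (‖projPerp (γ.deriv' u) (γ.toFun (u + w) - γ.toFun u)‖ ^ q /
        ‖γ.toFun (u + w) - γ.toFun u‖ ^ p * (‖γ.deriv' u‖ * ‖γ.deriv' (u + w)‖))

/-- The minorant `G^{(p,q)}_w`. -/
def Gw {n : ℕ} (p q : ℝ) (γ : ClosedCurve n) (w : ℝ) : ℝ≥0∞ :=
  ∫⁻ u in Set.Ioc (0:ℝ) 1,
    ENNReal.ofReal ((1/2 * gaussDerivU γ u w) ^ q *
      ‖γ.toFun (u + w) - γ.toFun u‖ ^ (2*q - p))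

/-- The minorant `G^{(p,q)}`. -/
def G {n : ℕ} (p q : ℝ) (γ : ClosedCurve n) : ℝ≥0∞ :=
  ∫⁻ w in Set.Ioc (0:ℝ) 1, Gw p q γ w

/-- A round circle in a euclidean space: a sphere intersected with a 2-dimensional plane
through its center. -/
def IsCircle {F : Type*} [NormedAddCommGroup F] [InnerProductSpace ℝ F] (S : Set F) : Prop :=
  ∃ (c : F) (r : ℝ) (V : Submodule ℝ F), 0 < r ∧ Module.finrank ℝ V = 2 ∧
    S = {x | ‖x - c‖ = r ∧ x - c ∈ V}

/-- A great circle of the unit sphere. -/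
def IsGreatCircle {F : Type*} [NormedAddCommGroup F] [InnerProductSpace ℝ F]
    (S : Set F) : Prop :=
  ∃ V : Submodule ℝ F, Module.finrank ℝ V = 2 ∧ S = {x | ‖x‖ = 1 ∧ x ∈ V}

/-- Half of a great circle of the unit sphere: a great-circle arc of angular length `π`. -/
def IsHalfGreatCircle {F : Type*} [NormedAddCommGroup F] [InnerProductSpace ℝ F]
    (S : Set F) : Prop :=
  ∃ a b : F, ‖a‖ = 1 ∧ ‖b‖ = 1 ∧ ⟪a, b⟫ = 0 ∧
    S = (fun t : ℝ => Real.cos t • a + Real.sin t • b) '' Set.Icc 0 π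

/-- A curve is convex if its image is the boundary (within its affine hull) of a convex
planar (2-dimensional) set. -/
def ClosedCurve.IsConvex {n : ℕ} (γ : ClosedCurve n) : Prop :=
  ∃ K : Set (EuclideanSpace ℝ (Fin n)), Convex ℝ K ∧
    Module.finrank ℝ (affineSpan ℝ K).direction = 2 ∧
    Set.range γ.toFun = intrinsicFrontier ℝ K

section TangentPointLowerBound

open Filter Topology

section RealAnalysis

theorem intervalIntegrable_and_integral_eq_sub_of_lipschitzOnWith {f f' : ℝ → ℝ} {a b : ℝ}
    {K : NNReal} (hab : a ≤ b) (hf : LipschitzOnWith K f (Icc a b))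
    (h : ∀ᵐ t, t ∈ Icc a b → HasDerivAt f (f' t) t) :
    IntervalIntegrable f' volume a b ∧ ∫ t in a..b, f' t = f b - f a := by
  rw [← uIcc_of_le hab] at hf h
  have hac := hf.absolutelyContinuousOnInterval
  have hae : ∀ᵐ t, t ∈ uIoc a b → deriv f t = f' t := by
    filter_upwards [h] with t ht hm
    exact (ht (uIoc_subset_uIcc hm)).deriv
  refine ⟨hac.intervalIntegrable_deriv.congr_ae ?_, ?_⟩
  · exact (ae_restrict_iff' measurableSet_uIoc).2 hae
  · rw [← hac.integral_deriv_eq_sub]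
    exact (intervalIntegral.integral_congr_ae hae).symm

/-- A locally Lipschitz function whose derivative agrees almost everywhere with a continuous
function is differentiable everywhere. -/
theorem hasDerivAt_of_ae_hasDerivAt {f k : ℝ → ℝ} (hk : ContinuousOn k (Ioo 0 1))
    (hf : ∀ a b, 0 < a → b < 1 → ∃ K, LipschitzOnWith K f (Icc a b))
    (h : ∀ᵐ t, t ∈ Ioo (0 : ℝ) 1 → HasDerivAt f (k t) t) {t : ℝ} (ht : t ∈ Ioo (0 : ℝ) 1) :
    HasDerivAt f (k t) t := by
  obtain ⟨a, ha0, hat⟩ := exists_between ht.1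
  obtain ⟨b, hbt, hb1⟩ := exists_between ht.2
  obtain ⟨K, hK⟩ := hf a b ha0 hb1
  have hsub : Icc a b ⊆ Ioo 0 1 := fun s hs => ⟨ha0.trans_le hs.1, hs.2.trans_lt hb1⟩
  have hintegral : ∀ s ∈ Icc a b, f s = f a + ∫ r in a..s, k r := by
    intro s hs
    have := (intervalIntegrable_and_integral_eq_sub_of_lipschitzOnWith (f' := k) hs.1
      (hK.mono (Icc_subset_Icc_right hs.2)) (h.mono fun r hr hr' =>
        hr (hsub ⟨hr'.1, hr'.2.trans hs.2⟩))).2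
    rw [this]; ring
  have hkc : ContinuousOn k (Icc a b) := hk.mono hsub
  have hd : HasDerivAt (fun s => ∫ r in a..s, k r) (k t) t := by
    refine intervalIntegral.integral_hasDerivAt_right ?_ ?_ ?_
    · refine ContinuousOn.intervalIntegrable ?_
      rw [uIcc_of_le hat.le]
      exact hkc.mono (Icc_subset_Icc_right hbt.le)
    · exact hk.stronglyMeasurableAtFilter isOpen_Ioo t ht
    · exact hk.continuousAt (Ioo_mem_nhds ht.1 ht.2)
  refine (hd.const_add (f a)).congr_of_eventuallyEq ?_
  filter_upwards [Icc_mem_nhds hat hbt] with s hs using hintegral s hs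

/-- A function on `(0, 1)` with vanishing derivative is constant. -/
theorem eq_of_hasDerivAt_zero {f : ℝ → ℝ} (h : ∀ t ∈ Ioo (0 : ℝ) 1, HasDerivAt f 0 t)
    {s t : ℝ} (hs : s ∈ Ioo (0 : ℝ) 1) (ht : t ∈ Ioo (0 : ℝ) 1) : f s = f t :=
  isOpen_Ioo.is_const_of_deriv_eq_zero isPreconnected_Ioo
    (fun x hx => (h x hx).differentiableAt.differentiableWithinAt)
    (fun x hx => (h x hx).deriv) hs ht

/-- A solution of a homogeneous linear ODE on `(0, 1)` that vanishes somewhere vanishes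
identically. -/
theorem eq_zero_of_hasDerivAt_mul {h m : ℝ → ℝ} (hm : ContinuousOn m (Ioo 0 1))
    (hh : ∀ t ∈ Ioo (0 : ℝ) 1, HasDerivAt h (m t * h t) t) {s t : ℝ}
    (hs : s ∈ Ioo (0 : ℝ) 1) (ht : t ∈ Ioo (0 : ℝ) 1) (h0 : h s = 0) : h t = 0 := by
  have hM : ∀ r ∈ Ioo (0 : ℝ) 1, HasDerivAt (fun r => ∫ x in s..r, m x) (m r) r := by
    intro r hr
    refine intervalIntegral.integral_hasDerivAt_right ?_ ?_ ?_
    · refine ContinuousOn.intervalIntegrable (hm.mono ?_)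
      exact ordConnected_Ioo.uIcc_subset hs hr
    · exact hm.stronglyMeasurableAtFilter isOpen_Ioo r hr
    · exact hm.continuousAt (Ioo_mem_nhds hr.1 hr.2)
  have hconst : ∀ r ∈ Ioo (0 : ℝ) 1,
      HasDerivAt (fun r => h r * exp (-∫ x in s..r, m x)) 0 r := by
    intro r hr
    refine ((hh r hr).mul (hM r hr).neg.exp).congr_deriv ?_
    ring
  have := eq_of_hasDerivAt_zero hconst ht hs
  simpa [h0, exp_ne_zero] using this

theorem chord_eq_sin_of_ode {c g : ℝ → ℝ} (hc0 : ∀ t ∈ Ioo (0 : ℝ) 1, 0 < c t)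
    (hg1 : ∀ t ∈ Ioo (0 : ℝ) 1, g t ^ 2 < 1)
    (hc : ∀ t ∈ Ioo (0 : ℝ) 1, HasDerivAt c (g t) t)
    (hg : ∀ t ∈ Ioo (0 : ℝ) 1, HasDerivAt g (-(1 - g t ^ 2) / c t) t)
    (hcl : Tendsto c (𝓝[>] 0) (𝓝 0)) (hgl : Tendsto g (𝓝[>] 0) (𝓝 1))
    (hcr : Tendsto c (𝓝[<] 1) (𝓝 0)) {t : ℝ} (ht : t ∈ Ioo (0 : ℝ) 1) :
    c t = sin (π * t) / π ∧ g t = cos (π * t) := by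
  have h12 : (1 / 2 : ℝ) ∈ Ioo (0 : ℝ) 1 := by norm_num
  have hκd : ∀ t ∈ Ioo (0 : ℝ) 1, HasDerivAt (fun s => (1 - g s ^ 2) / c s ^ 2) 0 t := by
    intro t ht
    have := hc0 t ht
    refine ((((hg t ht).pow 2).const_sub 1).div ((hc t ht).pow 2) (pow_pos this 2).ne').congr_deriv
      ?_
    simp only [Pi.pow_apply]
    field_simp
    ring
  obtain ⟨κ, hκ⟩ : ∃ κ, κ = (1 - g (1 / 2) ^ 2) / c (1 / 2) ^ 2 := ⟨_, rfl⟩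
  have hκ0 : 0 < κ := by
    rw [hκ]
    have := hc0 _ h12
    have := hg1 _ h12
    exact div_pos (by linarith) (by positivity)
  have hκt : ∀ t ∈ Ioo (0 : ℝ) 1, 1 - g t ^ 2 = κ * c t ^ 2 := by
    intro t ht
    have h1 := eq_of_hasDerivAt_zero hκd ht h12
    have := hc0 t ht
    simp only [← hκ] at h1
    field_simp at h1
    linarith
  obtain ⟨k, hk0, hk⟩ : ∃ k : ℝ, 0 < k ∧ κ = k ^ 2 := ⟨√κ, sqrt_pos.2 hκ0, (sq_sqrt hκ0.le).symm⟩
  have hg' : ∀ t ∈ Ioo (0 : ℝ) 1, HasDerivAt g (-k ^ 2 * c t) t := by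
    intro t ht
    refine (hg t ht).congr_deriv ?_
    have := hc0 t ht
    rw [hκt t ht, hk]
    field_simp
  have hkt : ∀ t : ℝ, HasDerivAt (fun s => k * s) k t := fun t => by
    simpa using (hasDerivAt_id t).const_mul k
  have hP : ∀ t ∈ Ioo (0 : ℝ) 1, HasDerivAt (fun s => c s * cos (k * s) - g s * sin (k * s) / k)
      0 t := by
    intro t ht
    refine (((hc t ht).mul (hkt t).cos).sub
      (((hg' t ht).mul (hkt t).sin).div_const k)).congr_deriv ?_
    field_simp
    ring
  have hQ : ∀ t ∈ Ioo (0 : ℝ) 1, HasDerivAt (fun s => k * (c s * sin (k * s)) + g s * cos (k * s))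
      0 t := by
    intro t ht
    refine ((((hc t ht).mul (hkt t).sin).const_mul k).add
      ((hg' t ht).mul (hkt t).cos)).congr_deriv ?_
    ring
  have hlim : ∀ {F : ℝ → ℝ} {L : ℝ}, (∀ t ∈ Ioo (0 : ℝ) 1, HasDerivAt F 0 t) →
      Tendsto F (𝓝[>] 0) (𝓝 L) → ∀ t ∈ Ioo (0 : ℝ) 1, F t = L := by
    intro F L hF hL t ht
    refine tendsto_nhds_unique (Tendsto.congr' ?_ tendsto_const_nhds) hL
    filter_upwards [Ioo_mem_nhdsGT (zero_lt_one' ℝ)] with s hs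
    exact eq_of_hasDerivAt_zero hF ht hs
  have hsl : Tendsto (fun s => sin (k * s)) (𝓝[>] 0) (𝓝 0) := by
    have : Continuous fun s => sin (k * s) := by fun_prop
    simpa using (this.tendsto 0).mono_left nhdsWithin_le_nhds
  have hcol : Tendsto (fun s => cos (k * s)) (𝓝[>] 0) (𝓝 1) := by
    have : Continuous fun s => cos (k * s) := by fun_prop
    simpa using (this.tendsto 0).mono_left nhdsWithin_le_nhds
  have hP0 := hlim (L := 0) hP (by
    simpa using (hcl.mul hcol).sub ((hgl.mul hsl).div_const k))
  have hQ1 := hlim (L := 1) hQ (by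
    simpa using ((hcl.mul hsl).const_mul k).add (hgl.mul hcol))
  have hsol : ∀ t ∈ Ioo (0 : ℝ) 1, c t = sin (k * t) / k ∧ g t = cos (k * t) := by
    intro t ht
    have h1 := hP0 t ht
    have h2 := hQ1 t ht
    have h3 := sin_sq_add_cos_sq (k * t)
    field_simp at h1
    constructor
    · field_simp
      linear_combination cos (k * t) * h1 + sin (k * t) * h2 - k * c t * h3
    · linear_combination cos (k * t) * h2 - sin (k * t) * h1 - g t * h3
  have hkπ : k ≤ π := by
    by_contra! hlt
    have hm : π / k ∈ Ioo (0 : ℝ) 1 := ⟨by positivity, (div_lt_one hk0).2 hlt⟩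
    have h1 := (hsol _ hm).1
    have h2 := hc0 _ hm
    rw [mul_div_cancel₀ _ hk0.ne', sin_pi, zero_div] at h1
    exact h2.ne' h1
  have hsk : sin k = 0 := by
    have h1 : Tendsto (fun s => sin (k * s) / k) (𝓝[<] 1) (𝓝 (sin (k * 1) / k)) := by
      have : Continuous fun s => sin (k * s) / k := by fun_prop
      exact (this.tendsto 1).mono_left nhdsWithin_le_nhds
    have h2 : sin (k * 1) / k = 0 := by
      refine tendsto_nhds_unique h1 (hcr.congr' ?_)
      filter_upwards [Ioo_mem_nhdsLT (zero_lt_one' ℝ)] with s hs using (hsol s hs).1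
    rw [mul_one, div_eq_zero_iff] at h2
    exact h2.resolve_right hk0.ne'
  have hkeq : k = π := by
    refine hkπ.eq_of_not_lt fun hlt => ?_
    exact (sin_pos_of_pos_of_lt_pi hk0 hlt).ne' hsk
  subst hkeq
  exact hsol t ht

end RealAnalysis

section Minorant

theorem mul_rpow_lt_weighted_rpow {q a b : ℝ} (hq : 1 < q) (ha : 0 ≤ a) (hb : 0 ≤ b)
    (hab : a ≠ b) : a * b ^ (q - 1) < q⁻¹ * a ^ q + (1 - q⁻¹) * b ^ q := by
  have hq0 : 0 < q := by linarith
  rcases hb.eq_or_lt with rfl | hb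
  · rw [zero_rpow (by linarith), zero_rpow (by linarith)]
    have : 0 < a := lt_of_le_of_ne ha (Ne.symm hab)
    simp only [mul_zero, add_zero]
    positivity
  · have h1 : -1 ≤ a / b - 1 := by
      have : 0 ≤ a / b := by positivity
      linarith
    have h2 : a / b - 1 ≠ 0 := by
      rw [sub_ne_zero, Ne, div_eq_one_iff_eq hb.ne']
      exact hab
    have h3 := one_add_mul_self_lt_rpow_one_add h1 h2 hq
    rw [add_sub_cancel, div_rpow ha hb.le, lt_div_iff₀ (by positivity)] at h3
    have h4 : b ^ q = b ^ (q - 1) * b := by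
      rw [← rpow_add_one hb.ne', sub_add_cancel]
    have h5 : (1 + q * (a / b - 1)) * b ^ q = q * (a * b ^ (q - 1)) + (1 - q) * b ^ q := by
      rw [h4]
      field_simp
      ring
    rw [h5] at h3
    have h6 : q⁻¹ * (q * (a * b ^ (q - 1)) + (1 - q) * b ^ q) < q⁻¹ * a ^ q := by gcongr
    have h7 : q⁻¹ * (q * (a * b ^ (q - 1)) + (1 - q) * b ^ q) =
        a * b ^ (q - 1) - (1 - q⁻¹) * b ^ q := by
      field_simp
      ring
    linarith

theorem mul_rpow_le_weighted_rpow {q a b : ℝ} (hq : 1 < q) (ha : 0 ≤ a) (hb : 0 ≤ b) :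
    a * b ^ (q - 1) ≤ q⁻¹ * a ^ q + (1 - q⁻¹) * b ^ q := by
  rcases eq_or_ne a b with rfl | hab
  · have : a ^ q = a * a ^ (q - 1) := by
      rcases ha.eq_or_lt with rfl | ha
      · rw [zero_rpow (by linarith), zero_mul]
      · rw [mul_comm, ← rpow_add_one ha.ne', sub_add_cancel]
    rw [← this]
    exact le_of_eq (by ring)
  · exact (mul_rpow_lt_weighted_rpow hq ha hb hab).le

/-- The sine of the angle whose cosine is `x`. -/
def sinOfCos (x : ℝ) : ℝ := √(1 - x ^ 2)

theorem continuous_sinOfCos : Continuous sinOfCos := by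
  unfold sinOfCos
  fun_prop

theorem sinOfCos_nonneg (x : ℝ) : 0 ≤ sinOfCos x := sqrt_nonneg _

theorem sinOfCos_le_one (x : ℝ) : sinOfCos x ≤ 1 := by
  exact sqrt_le_iff.2 ⟨zero_le_one, by nlinarith [sq_nonneg x]⟩

theorem sinOfCos_cos {θ : ℝ} (h : θ ∈ Icc 0 π) : sinOfCos (cos θ) = sin θ := by
  rw [sinOfCos, ← sin_sq, sqrt_sq (sin_nonneg_of_mem_Icc h)]

/-- A bounded regularization of the density `(1 - s²)^((q-2)/2)`. -/
def regWeight (q ε s : ℝ) : ℝ := sinOfCos s ^ (q - 1) / (sinOfCos s + ε)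

theorem continuous_regWeight {q ε : ℝ} (hq : 1 < q) (hε : 0 < ε) : Continuous (regWeight q ε) := by
  unfold regWeight
  refine Continuous.div ?_ ?_ fun s => ?_
  · exact continuous_sinOfCos.rpow_const fun s => Or.inr (by linarith)
  · exact continuous_sinOfCos.add continuous_const
  · have := sinOfCos_nonneg s
    positivity

theorem regWeight_nonneg (q : ℝ) {ε : ℝ} (hε : 0 < ε) (s : ℝ) : 0 ≤ regWeight q ε s := by
  have := sinOfCos_nonneg s
  unfold regWeight
  positivity

theorem regWeight_le {q ε : ℝ} (hq : 1 < q) (hε : 0 < ε) (s : ℝ) : regWeight q ε s ≤ 1 / ε := by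
  have h0 := sinOfCos_nonneg s
  unfold regWeight
  gcongr
  · exact rpow_le_one h0 (sinOfCos_le_one s) (by linarith)
  · linarith

theorem sinOfCos_mul_regWeight_le (q : ℝ) {ε : ℝ} (hε : 0 < ε) (s : ℝ) :
    sinOfCos s * regWeight q ε s ≤ sinOfCos s ^ (q - 1) := by
  have h0 := sinOfCos_nonneg s
  have h1 : 0 ≤ sinOfCos s ^ (q - 1) := by positivity
  rw [regWeight, mul_div_assoc', div_le_iff₀ (by positivity)]
  nlinarith

theorem tendsto_inv_nat_add_one : Tendsto (fun m : ℕ => (1 : ℝ) / (m + 1)) atTop (𝓝 0) :=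
  tendsto_one_div_add_atTop_nhds_zero_nat

theorem tendsto_regWeight {q : ℝ} (hq : 1 < q) (s : ℝ) :
    Tendsto (fun m : ℕ => regWeight q (1 / (m + 1)) s) atTop
      (𝓝 (sinOfCos s ^ (q - 1) / sinOfCos s)) := by
  rcases (sinOfCos_nonneg s).eq_or_lt with h | h
  · simp [regWeight, ← h, zero_rpow (show q - 1 ≠ 0 by linarith)]
  · unfold regWeight
    refine tendsto_const_nhds.div ?_ h.ne'
    simpa using tendsto_inv_nat_add_one.const_add (sinOfCos s)

theorem integral_regWeight {q ε : ℝ} (hq : 1 < q) (hε : 0 < ε) :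
    ∫ s in (-1 : ℝ)..1, regWeight q ε s =
      ∫ θ in (0 : ℝ)..π, sin θ ^ (q - 1) / (sin θ + ε) * sin θ := by
  have h := intervalIntegral.integral_comp_mul_deriv (a := 0) (b := π) (f := cos)
    (f' := fun θ => -sin θ) (g := regWeight q ε) (fun θ _ => hasDerivAt_cos θ)
    (by fun_prop) (continuous_regWeight hq hε)
  rw [cos_zero, cos_pi, intervalIntegral.integral_symm (-1) 1, ← neg_eq_iff_eq_neg] at h
  rw [← h, ← intervalIntegral.integral_neg]
  refine intervalIntegral.integral_congr fun θ hθ => ?_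
  rw [uIcc_of_le pi_pos.le] at hθ
  simp [regWeight, sinOfCos_cos hθ]

theorem tendsto_integral_regWeight {q : ℝ} (hq : 1 < q) :
    Tendsto (fun m : ℕ => ∫ s in (-1 : ℝ)..1, regWeight q (1 / (m + 1)) s) atTop
      (𝓝 (∫ θ in (0 : ℝ)..π, sin θ ^ (q - 1))) := by
  simp_rw [fun m : ℕ => integral_regWeight hq (Nat.one_div_pos_of_nat (α := ℝ) (n := m))]
  refine intervalIntegral.tendsto_integral_filter_of_dominated_convergence (fun _ => 1) ?_ ?_ ?_ ?_
  · refine Eventually.of_forall fun m => Measurable.aestronglyMeasurable ?_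
    fun_prop
  · refine Eventually.of_forall fun m => Eventually.of_forall fun θ hθ => ?_
    rw [uIoc_of_le pi_pos.le] at hθ
    have h0 : 0 ≤ sin θ := sin_nonneg_of_mem_Icc ⟨hθ.1.le, hθ.2⟩
    have h1 : sin θ ^ (q - 1) ≤ 1 := rpow_le_one h0 (sin_le_one θ) (by linarith)
    have h2 : 0 ≤ sin θ ^ (q - 1) := by positivity
    have h3 : (0 : ℝ) < 1 / (m + 1) := Nat.one_div_pos_of_nat
    rw [norm_of_nonneg (by positivity), div_mul_eq_mul_div, div_le_one (by positivity)]
    nlinarith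
  · exact intervalIntegrable_const
  · refine Eventually.of_forall fun θ hθ => ?_
    rw [uIoc_of_le pi_pos.le] at hθ
    rcases (sin_nonneg_of_mem_Icc ⟨hθ.1.le, hθ.2⟩ : 0 ≤ sin θ).eq_or_lt with h | h
    · simp [← h, zero_rpow (show q - 1 ≠ 0 by linarith)]
    · have h1 : Tendsto (fun m : ℕ => sin θ + (1 : ℝ) / (m + 1)) atTop (𝓝 (sin θ)) := by
        simpa using tendsto_inv_nat_add_one.const_add (sin θ)
      have h2 := ((tendsto_const_nhds (x := sin θ ^ (q - 1))).div h1 h.ne').mul_const (sin θ)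
      rwa [div_mul_cancel₀ _ h.ne'] at h2

theorem pi_mul_integral_sin_rpow (q : ℝ) :
    π * ∫ w in (0 : ℝ)..1, sin (π * w) ^ (q - 1) = ∫ θ in (0 : ℝ)..π, sin θ ^ (q - 1) := by
  rw [intervalIntegral.mul_integral_comp_mul_left (f := fun θ => sin θ ^ (q - 1))]
  simp

/-- The symmetrized tangent-point integrand in terms of the chord length `c` and the cosines
`x`, `y` of the angles between the chord and the tangents at its two end points. -/
def symmIntegrand (q c x y : ℝ) : ℝ :=
  (q⁻¹ * sinOfCos y ^ q + (1 - q⁻¹) * sinOfCos x ^ q) / c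

theorem symmIntegrand_nonneg {q c : ℝ} (hq : 1 < q) (hc : 0 < c) (x y : ℝ) :
    0 ≤ symmIntegrand q c x y := by
  have := sinOfCos_nonneg x
  have := sinOfCos_nonneg y
  have : 0 ≤ 1 - q⁻¹ := sub_nonneg.2 (inv_le_one_of_one_le₀ hq.le)
  unfold symmIntegrand
  positivity

theorem abs_mul_regWeight_le_symmIntegrand {q c x y z ε : ℝ} (hq : 1 < q) (hc : 0 < c)
    (hε : 0 < ε) (hz : |z| * c ≤ sinOfCos x * sinOfCos y) :
    |z| * regWeight q ε x ≤ symmIntegrand q c x y := by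
  have hx := sinOfCos_nonneg x
  have hy := sinOfCos_nonneg y
  rw [symmIntegrand, le_div_iff₀ hc]
  calc |z| * regWeight q ε x * c = |z| * c * regWeight q ε x := by ring
    _ ≤ sinOfCos x * sinOfCos y * regWeight q ε x := by
        gcongr
        exact regWeight_nonneg q hε x
    _ = sinOfCos y * (sinOfCos x * regWeight q ε x) := by ring
    _ ≤ sinOfCos y * sinOfCos x ^ (q - 1) := by
        gcongr
        exact sinOfCos_mul_regWeight_le q hε x
    _ ≤ _ := mul_rpow_le_weighted_rpow hq hy hx

/-- The equality case of `abs_mul_regWeight_le_symmIntegrand` in the limit `ε → 0`. -/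
theorem eq_of_symmIntegrand_eq {q c x y z : ℝ} (hq : 1 < q) (hc : 0 < c)
    (hz : |z| * c ≤ sinOfCos x * sinOfCos y)
    (h : symmIntegrand q c x y = -z * (sinOfCos x ^ (q - 1) / sinOfCos x)) :
    sinOfCos y = sinOfCos x ∧ z * c = -sinOfCos x ^ 2 := by
  have hx := sinOfCos_nonneg x
  have hy := sinOfCos_nonneg y
  rw [symmIntegrand, div_eq_iff hc.ne'] at h
  have hzz := neg_abs_le z
  rcases hx.eq_or_lt with h0 | h0
  · rw [← h0] at h hz ⊢
    have hz0 : |z| * c = 0 := le_antisymm (by simpa using hz) (by positivity)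
    have hz1 : z = 0 := by simpa [hc.ne'] using hz0
    rw [zero_rpow (by linarith), zero_rpow (by linarith)] at h
    have hyq : sinOfCos y ^ q = 0 := by
      have : q⁻¹ ≠ 0 := by positivity
      simpa [this] using h
    exact ⟨(rpow_eq_zero hy (by linarith)).1 hyq, by simp [hz1]⟩
  · have hp : 0 < sinOfCos x ^ (q - 1) := by positivity
    have h1 : -z * c ≤ sinOfCos x * sinOfCos y := by nlinarith
    have h2 : -z * (sinOfCos x ^ (q - 1) / sinOfCos x) * c =
        (-z * c) * (sinOfCos x ^ (q - 1) / sinOfCos x) := by ring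
    have h3 : (-z * c) * (sinOfCos x ^ (q - 1) / sinOfCos x) ≤
        sinOfCos x * sinOfCos y * (sinOfCos x ^ (q - 1) / sinOfCos x) := by gcongr
    have h4 : sinOfCos x * sinOfCos y * (sinOfCos x ^ (q - 1) / sinOfCos x) =
        sinOfCos y * sinOfCos x ^ (q - 1) := by field_simp
    have hxy : sinOfCos y = sinOfCos x := by
      by_contra hne
      have := mul_rpow_lt_weighted_rpow hq hy hx hne
      linarith
    refine ⟨hxy, ?_⟩
    have h5 := mul_rpow_le_weighted_rpow hq hy hx
    have h6 : (-z * c) * (sinOfCos x ^ (q - 1) / sinOfCos x) =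
        sinOfCos x * sinOfCos y * (sinOfCos x ^ (q - 1) / sinOfCos x) := by linarith
    have h7 := mul_right_cancel₀ (by positivity) h6
    rw [hxy] at h7
    linarith

end Minorant

section SinglePoint

theorem exists_lipschitzOnWith_comp {F g : ℝ → ℝ} {L : NNReal} (hF : LipschitzWith L F)
    (hg : ∀ a b, 0 < a → b < 1 → ∃ K, LipschitzOnWith K g (Icc a b)) :
    ∀ a b, 0 < a → b < 1 → ∃ K, LipschitzOnWith K (F ∘ g) (Icc a b) := fun a b ha hb => by
  obtain ⟨K, hK⟩ := hg a b ha hb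
  exact ⟨L * K, hF.comp_lipschitzOnWith hK⟩

theorem continuousOn_of_exists_lipschitzOnWith {g : ℝ → ℝ}
    (hg : ∀ a b, 0 < a → b < 1 → ∃ K, LipschitzOnWith K g (Icc a b)) :
    ContinuousOn g (Ioo 0 1) := by
  intro t ht
  obtain ⟨a, ha0, hat⟩ := exists_between ht.1
  obtain ⟨b, hbt, hb1⟩ := exists_between ht.2
  obtain ⟨K, hK⟩ := hg a b ha0 hb1
  exact (hK.continuousOn.continuousAt (Icc_mem_nhds hat hbt)).continuousWithinAt

theorem hasDerivAt_integral_regWeight {q ε : ℝ} (hq : 1 < q) (hε : 0 < ε) (s : ℝ) :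
    HasDerivAt (fun s => ∫ r in (0 : ℝ)..s, regWeight q ε r) (regWeight q ε s) s :=
  intervalIntegral.integral_hasDerivAt_right
    ((continuous_regWeight hq hε).intervalIntegrable _ _)
    ((continuous_regWeight hq hε).stronglyMeasurableAtFilter _ _)
    (continuous_regWeight hq hε).continuousAt

theorem lipschitzWith_integral_regWeight {q ε : ℝ} (hq : 1 < q) (hε : 0 < ε) :
    LipschitzWith (1 / ε).toNNReal (fun s => ∫ r in (0 : ℝ)..s, regWeight q ε r) := by
  refine lipschitzWith_of_nnnorm_deriv_le
    (fun s => (hasDerivAt_integral_regWeight hq hε s).differentiableAt) fun s => ?_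
  rw [(hasDerivAt_integral_regWeight hq hε s).deriv, ← NNReal.coe_le_coe, coe_nnnorm,
    norm_of_nonneg (regWeight_nonneg q hε s), coe_toNNReal _ (by positivity)]
  exact regWeight_le hq hε s

variable {q : ℝ} {c g g₂ g' : ℝ → ℝ}

/-- The improper integral of `-g' · regWeight ∘ g` over `(0, 1)`, where `g` runs from `1` to
`-1`. -/
theorem integral_neg_deriv_mul_regWeight {ε : ℝ} (hq : 1 < q) (hε : 0 < ε)
    (hlip : ∀ a b, 0 < a → b < 1 → ∃ K, LipschitzOnWith K g (Icc a b))
    (hd : ∀ᵐ w, w ∈ Ioo (0 : ℝ) 1 → HasDerivAt g (g' w) w)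
    (h0 : Tendsto g (𝓝[>] 0) (𝓝 1)) (h1 : Tendsto g (𝓝[<] 1) (𝓝 (-1)))
    (hintegral : IntegrableOn (fun w => -g' w * regWeight q ε (g w)) (Ioo 0 1)) :
    ∫ w in Ioo (0 : ℝ) 1, -g' w * regWeight q ε (g w) =
      ∫ s in (-1 : ℝ)..1, regWeight q ε s := by
  obtain ⟨H, hH⟩ : ∃ H : ℝ → ℝ, H = fun s => ∫ r in (0 : ℝ)..s, regWeight q ε r := ⟨_, rfl⟩
  have hHd : ∀ s, HasDerivAt H (regWeight q ε s) s := hH ▸ hasDerivAt_integral_regWeight hq hε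
  have hHc : Continuous H := continuous_iff_continuousAt.2 fun s => (hHd s).continuousAt
  have ha : Tendsto (fun k : ℕ => (1 : ℝ) / (k + 3)) atTop (𝓝 0) := by
    have := (tendsto_add_atTop_iff_nat 2).2 tendsto_inv_nat_add_one
    refine this.congr fun k => ?_
    push_cast
    ring
  have hb : Tendsto (fun k : ℕ => 1 - (1 : ℝ) / (k + 3)) atTop (𝓝 1) := by
    simpa using ha.const_sub 1
  have hpos : ∀ k : ℕ, (0 : ℝ) < 1 / (k + 3) := fun k => by positivity
  have hle : ∀ k : ℕ, (1 : ℝ) / (k + 3) ≤ 1 / 3 := fun k => by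
    gcongr
    have : (0 : ℝ) ≤ k := k.cast_nonneg
    linarith
  refine (aecover_Ioo_of_Ioc ha hb).integral_eq_of_tendsto _ hintegral ?_
  have hk : ∀ k : ℕ, ∫ w in Ioc ((1 : ℝ) / (k + 3)) (1 - 1 / (k + 3)),
      -g' w * regWeight q ε (g w) ∂(volume.restrict (Ioo 0 1)) =
      H (g (1 / (k + 3))) - H (g (1 - 1 / (k + 3))) := by
    intro k
    have := hpos k
    have := hle k
    have hsub : Icc ((1 : ℝ) / (k + 3)) (1 - 1 / (k + 3)) ⊆ Ioo 0 1 := fun w hw =>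
      ⟨by linarith [hw.1], by linarith [hw.2]⟩
    obtain ⟨K, hK⟩ := exists_lipschitzOnWith_comp
      (hH ▸ lipschitzWith_integral_regWeight hq hε) hlip
      (1 / (k + 3)) (1 - 1 / (k + 3)) (by linarith) (by linarith)
    have hf := (intervalIntegrable_and_integral_eq_sub_of_lipschitzOnWith
      (f' := fun w => regWeight q ε (g w) * g' w) (by linarith) hK (by
        filter_upwards [hd] with w hw hm
        exact (hHd (g w)).comp w (hw (hsub hm)))).2
    rw [Measure.restrict_restrict measurableSet_Ioc,
      inter_eq_left.2 (Ioc_subset_Icc_self.trans hsub),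
      ← intervalIntegral.integral_of_le (by linarith)]
    rw [Function.comp_apply, Function.comp_apply] at hf
    rw [← neg_sub (H (g (1 - 1 / (k + 3)))), ← hf, ← intervalIntegral.integral_neg]
    congr 1
    ext w
    ring
  simp_rw [hk]
  have hI : ∫ s in (-1 : ℝ)..1, regWeight q ε s = H 1 - H (-1) := by
    rw [hH, intervalIntegral.integral_interval_sub_left] <;>
    exact (continuous_regWeight hq hε).intervalIntegrable _ _
  rw [hI]
  refine Tendsto.sub ?_ ?_
  · refine (hHc.tendsto 1).comp (h0.comp ?_)
    exact tendsto_nhdsWithin_iff.2 ⟨ha, Eventually.of_forall hpos⟩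
  · refine (hHc.tendsto (-1)).comp (h1.comp ?_)
    exact tendsto_nhdsWithin_iff.2
      ⟨hb, Eventually.of_forall fun k => sub_lt_self 1 (hpos k)⟩

theorem integrable_neg_deriv_mul_regWeight {ε : ℝ} (hq : 1 < q) (hε : 0 < ε)
    (hc : ∀ w ∈ Ioo (0 : ℝ) 1, 0 < c w)
    (hlip : ∀ a b, 0 < a → b < 1 → ∃ K, LipschitzOnWith K g (Icc a b))
    (hd : ∀ᵐ w, w ∈ Ioo (0 : ℝ) 1 → HasDerivAt g (g' w) w)
    (hcs : ∀ᵐ w, w ∈ Ioo (0 : ℝ) 1 → |g' w| * c w ≤ sinOfCos (g w) * sinOfCos (g₂ w))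
    (hB : IntegrableOn (fun w => symmIntegrand q (c w) (g w) (g₂ w)) (Ioo 0 1)) :
    IntegrableOn (fun w => -g' w * regWeight q ε (g w)) (Ioo 0 1) := by
  refine Integrable.mono' hB ?_ ?_
  · have hg := (continuousOn_of_exists_lipschitzOnWith hlip)
    have hm1 : AEStronglyMeasurable g' (volume.restrict (Ioo 0 1)) := by
      refine (measurable_deriv g).aestronglyMeasurable.congr ?_
      filter_upwards [(ae_restrict_iff' measurableSet_Ioo).2 hd] with w hw using hw.deriv
    exact hm1.neg.mul (((continuous_regWeight hq hε).comp_continuousOn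
      hg).aestronglyMeasurable measurableSet_Ioo)
  · filter_upwards [(ae_restrict_iff' measurableSet_Ioo).2 hcs,
      ae_restrict_mem measurableSet_Ioo] with w hw hm
    rw [norm_mul, norm_neg, norm_eq_abs, norm_of_nonneg (regWeight_nonneg q hε _)]
    exact abs_mul_regWeight_le_symmIntegrand hq (hc w hm) hε hw

theorem integral_sin_rpow_nonneg (q : ℝ) : 0 ≤ ∫ θ in (0 : ℝ)..π, sin θ ^ (q - 1) :=
  intervalIntegral.integral_nonneg pi_pos.le fun _ hθ =>
    rpow_nonneg (sin_nonneg_of_mem_Icc hθ) _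

theorem integral_sin_rpow_le_integral_symmIntegrand (hq : 1 < q)
    (hc : ∀ w ∈ Ioo (0 : ℝ) 1, 0 < c w)
    (hlip : ∀ a b, 0 < a → b < 1 → ∃ K, LipschitzOnWith K g (Icc a b))
    (hd : ∀ᵐ w, w ∈ Ioo (0 : ℝ) 1 → HasDerivAt g (g' w) w)
    (hcs : ∀ᵐ w, w ∈ Ioo (0 : ℝ) 1 → |g' w| * c w ≤ sinOfCos (g w) * sinOfCos (g₂ w))
    (h0 : Tendsto g (𝓝[>] 0) (𝓝 1)) (h1 : Tendsto g (𝓝[<] 1) (𝓝 (-1)))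
    (hB : IntegrableOn (fun w => symmIntegrand q (c w) (g w) (g₂ w)) (Ioo 0 1)) :
    ∫ θ in (0 : ℝ)..π, sin θ ^ (q - 1) ≤
      ∫ w in Ioo (0 : ℝ) 1, symmIntegrand q (c w) (g w) (g₂ w) := by
  refine le_of_tendsto' (tendsto_integral_regWeight hq) fun m => ?_
  have hε : (0 : ℝ) < 1 / (m + 1) := Nat.one_div_pos_of_nat
  have hP := integrable_neg_deriv_mul_regWeight hq hε hc hlip hd hcs hB
  rw [← integral_neg_deriv_mul_regWeight hq hε hlip hd h0 h1 hP]
  refine integral_mono_ae hP hB ?_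
  filter_upwards [(ae_restrict_iff' measurableSet_Ioo).2 hcs,
    ae_restrict_mem measurableSet_Ioo] with w hw hm
  exact (mul_le_mul_of_nonneg_right (neg_le_abs _) (regWeight_nonneg q hε _)).trans
    (abs_mul_regWeight_le_symmIntegrand hq (hc w hm) hε hw)

theorem ae_eq_of_integral_symmIntegrand_eq (hq : 1 < q)
    (hc : ∀ w ∈ Ioo (0 : ℝ) 1, 0 < c w)
    (hlip : ∀ a b, 0 < a → b < 1 → ∃ K, LipschitzOnWith K g (Icc a b))
    (hd : ∀ᵐ w, w ∈ Ioo (0 : ℝ) 1 → HasDerivAt g (g' w) w)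
    (hcs : ∀ᵐ w, w ∈ Ioo (0 : ℝ) 1 → |g' w| * c w ≤ sinOfCos (g w) * sinOfCos (g₂ w))
    (h0 : Tendsto g (𝓝[>] 0) (𝓝 1)) (h1 : Tendsto g (𝓝[<] 1) (𝓝 (-1)))
    (hB : IntegrableOn (fun w => symmIntegrand q (c w) (g w) (g₂ w)) (Ioo 0 1))
    (heq : ∫ w in Ioo (0 : ℝ) 1, symmIntegrand q (c w) (g w) (g₂ w) =
      ∫ θ in (0 : ℝ)..π, sin θ ^ (q - 1)) :
    ∀ᵐ w, w ∈ Ioo (0 : ℝ) 1 →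
      sinOfCos (g₂ w) = sinOfCos (g w) ∧ g' w * c w = -sinOfCos (g w) ^ 2 := by
  have hε : ∀ m : ℕ, (0 : ℝ) < 1 / (m + 1) := fun m => Nat.one_div_pos_of_nat
  have hP := fun m => integrable_neg_deriv_mul_regWeight hq (hε m) hc hlip hd hcs hB
  have hcs' := (ae_restrict_iff' measurableSet_Ioo).2 hcs
  have hlim : ∀ w, Tendsto (fun m : ℕ => -g' w * regWeight q (1 / (m + 1)) (g w)) atTop
      (𝓝 (-g' w * (sinOfCos (g w) ^ (q - 1) / sinOfCos (g w)))) := fun w =>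
    (tendsto_regWeight hq _).const_mul _
  have hbound : ∀ m : ℕ, ∀ᵐ w ∂volume.restrict (Ioo (0 : ℝ) 1),
      ‖-g' w * regWeight q (1 / (m + 1)) (g w)‖ ≤ symmIntegrand q (c w) (g w) (g₂ w) := by
    intro m
    filter_upwards [hcs', ae_restrict_mem measurableSet_Ioo] with w hw hm
    rw [norm_mul, norm_neg, norm_eq_abs, norm_of_nonneg (regWeight_nonneg q (hε m) _)]
    exact abs_mul_regWeight_le_symmIntegrand hq (hc w hm) (hε m) hw
  have hbound' : ∀ᵐ w ∂volume.restrict (Ioo (0 : ℝ) 1),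
      ‖-g' w * (sinOfCos (g w) ^ (q - 1) / sinOfCos (g w))‖ ≤
        symmIntegrand q (c w) (g w) (g₂ w) := by
    filter_upwards [ae_all_iff.2 hbound] with w hw
    exact le_of_tendsto' (hlim w).norm hw
  have hQ : IntegrableOn (fun w => -g' w * (sinOfCos (g w) ^ (q - 1) / sinOfCos (g w)))
      (Ioo 0 1) :=
    Integrable.mono' hB (aestronglyMeasurable_of_tendsto_ae atTop (fun m => (hP m).1)
      (Eventually.of_forall hlim)) hbound'
  have hintegral : ∫ w in Ioo (0 : ℝ) 1, -g' w * (sinOfCos (g w) ^ (q - 1) / sinOfCos (g w)) =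
      ∫ θ in (0 : ℝ)..π, sin θ ^ (q - 1) := by
    refine tendsto_nhds_unique (tendsto_integral_of_dominated_convergence _
      (fun m => (hP m).1) hB hbound (Eventually.of_forall hlim)) ?_
    refine (tendsto_integral_regWeight hq).congr fun m => ?_
    exact (integral_neg_deriv_mul_regWeight hq (hε m) hlip hd h0 h1 (hP m)).symm
  have hz := (integral_eq_zero_iff_of_nonneg_ae ?_ (hB.sub hQ)).1 (by
    rw [← sub_eq_zero, ← hintegral, ← integral_sub hB hQ] at heq
    exact heq)
  · refine (ae_restrict_iff' measurableSet_Ioo).1 ?_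
    filter_upwards [hz, hcs', ae_restrict_mem measurableSet_Ioo] with w hw hw' hm
    exact eq_of_symmIntegrand_eq hq (hc w hm) hw' (sub_eq_zero.1 hw)
  · filter_upwards [hbound'] with w hw
    exact sub_nonneg.2 ((le_norm_self _).trans hw)

/-- The lower bound for the symmetrized energy density at a point, with its equality case. -/
theorem lintegral_symmIntegrand (hq : 1 < q)
    (hc : ∀ w ∈ Ioo (0 : ℝ) 1, 0 < c w)
    (hcm : ContinuousOn c (Ioo 0 1)) (hg₂ : AEMeasurable g₂ (volume.restrict (Ioo 0 1)))
    (hlip : ∀ a b, 0 < a → b < 1 → ∃ K, LipschitzOnWith K g (Icc a b))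
    (hd : ∀ᵐ w, w ∈ Ioo (0 : ℝ) 1 → HasDerivAt g (g' w) w)
    (hcs : ∀ᵐ w, w ∈ Ioo (0 : ℝ) 1 → |g' w| * c w ≤ sinOfCos (g w) * sinOfCos (g₂ w))
    (h0 : Tendsto g (𝓝[>] 0) (𝓝 1)) (h1 : Tendsto g (𝓝[<] 1) (𝓝 (-1))) :
    ENNReal.ofReal (∫ θ in (0 : ℝ)..π, sin θ ^ (q - 1)) ≤
        ∫⁻ w in Ioo (0 : ℝ) 1, ENNReal.ofReal (symmIntegrand q (c w) (g w) (g₂ w)) ∧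
      (∫⁻ w in Ioo (0 : ℝ) 1, ENNReal.ofReal (symmIntegrand q (c w) (g w) (g₂ w)) =
        ENNReal.ofReal (∫ θ in (0 : ℝ)..π, sin θ ^ (q - 1)) →
      ∀ᵐ w, w ∈ Ioo (0 : ℝ) 1 →
        sinOfCos (g₂ w) = sinOfCos (g w) ∧ g' w * c w = -sinOfCos (g w) ^ 2) := by
  have hnn : ∀ᵐ w ∂volume.restrict (Ioo (0 : ℝ) 1),
      0 ≤ symmIntegrand q (c w) (g w) (g₂ w) := by
    filter_upwards [ae_restrict_mem measurableSet_Ioo] with w hm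
    exact symmIntegrand_nonneg hq (hc w hm) _ _
  have hmeas : AEMeasurable (fun w => symmIntegrand q (c w) (g w) (g₂ w))
      (volume.restrict (Ioo (0 : ℝ) 1)) := by
    have hg := (continuousOn_of_exists_lipschitzOnWith hlip).aemeasurable
      (μ := volume) measurableSet_Ioo
    have hcm' := hcm.aemeasurable (μ := volume) measurableSet_Ioo
    have hs := continuous_sinOfCos.measurable
    unfold symmIntegrand
    exact ((((hs.comp_aemeasurable hg₂).pow_const q).const_mul _).add
      (((hs.comp_aemeasurable hg).pow_const q).const_mul _)).div hcm'
  by_cases hfin : ∫⁻ w in Ioo (0 : ℝ) 1,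
      ENNReal.ofReal (symmIntegrand q (c w) (g w) (g₂ w)) = ⊤
  · rw [hfin]
    exact ⟨le_top, fun h => absurd h ENNReal.top_ne_ofReal⟩
  · have hB : IntegrableOn (fun w => symmIntegrand q (c w) (g w) (g₂ w)) (Ioo 0 1) := by
      refine ⟨hmeas.aestronglyMeasurable, ?_⟩
      rw [hasFiniteIntegral_iff_ofReal hnn]
      exact lt_top_iff_ne_top.2 hfin
    rw [← ofReal_integral_eq_lintegral_ofReal hB hnn]
    refine ⟨ENNReal.ofReal_le_ofReal
      (integral_sin_rpow_le_integral_symmIntegrand hq hc hlip hd hcs h0 h1 hB), fun h => ?_⟩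
    rw [ENNReal.ofReal_eq_ofReal_iff (integral_nonneg_of_ae hnn)
      (integral_sin_rpow_nonneg q)] at h
    exact ae_eq_of_integral_symmIntegrand_eq hq hc hlip hd hcs h0 h1 hB h

end SinglePoint

section Chord

variable {E : Type*} [NormedAddCommGroup E] [InnerProductSpace ℝ E]

theorem norm_sub_inner_smul_sq {x e : E} (hx : ‖x‖ = 1) (he : ‖e‖ = 1) :
    ‖x - ⟪x, e⟫ • e‖ ^ 2 = 1 - ⟪x, e⟫ ^ 2 := by
  rw [norm_sub_sq_real, inner_smul_right, norm_smul, hx, he, norm_eq_abs, mul_one, sq_abs]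
  ring

theorem norm_sub_inner_smul {x e : E} (hx : ‖x‖ = 1) (he : ‖e‖ = 1) :
    ‖x - ⟪x, e⟫ • e‖ = sinOfCos ⟪x, e⟫ := by
  rw [sinOfCos, ← norm_sub_inner_smul_sq hx he, sqrt_sq (norm_nonneg _)]

theorem norm_projPerp {T : E} (hT : ‖T‖ = 1) {x : E} (hx : x ≠ 0) :
    ‖projPerp T x‖ = ‖x‖ * sinOfCos (⟪T, x⟫ / ‖x‖) := by
  have hx' : 0 < ‖x‖ := norm_pos_iff.2 hx
  have he : ‖‖x‖⁻¹ • x‖ = 1 := norm_smul_inv_norm hx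
  have h := norm_sub_inner_smul he hT
  have h1 : ⟪‖x‖⁻¹ • x, T⟫ = ⟪T, x⟫ / ‖x‖ := by
    rw [real_inner_smul_left, real_inner_comm, inv_mul_eq_div]
  have h2 : projPerp T x = ‖x‖ • (‖x‖⁻¹ • x - ⟪‖x‖⁻¹ • x, T⟫ • T) := by
    rw [h1, smul_sub, smul_inv_smul₀ hx'.ne', smul_smul, mul_div_cancel₀ _ hx'.ne', projPerp, hT]
    simp
  rw [h2, norm_smul, h, h1, norm_norm]

theorem norm_projPerp_rpow_div {T : E} (hT : ‖T‖ = 1) {x : E} (hx : x ≠ 0) (q : ℝ) :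
    ‖projPerp T x‖ ^ q / ‖x‖ ^ (q + 1) = sinOfCos (⟪T, x⟫ / ‖x‖) ^ q / ‖x‖ := by
  have hx' : 0 < ‖x‖ := norm_pos_iff.2 hx
  rw [norm_projPerp hT hx, mul_rpow hx'.le (sinOfCos_nonneg _), rpow_add_one hx'.ne']
  have : 0 < ‖x‖ ^ q := by positivity
  field_simp

theorem sinOfCos_neg (x : ℝ) : sinOfCos (-x) = sinOfCos x := by
  rw [sinOfCos, sinOfCos, neg_sq]

theorem abs_inner_div_norm_le_one {T : E} (hT : ‖T‖ = 1) (x : E) : |⟪T, x⟫ / ‖x‖| ≤ 1 := by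
  rw [abs_div, abs_norm]
  refine div_le_one_of_le₀ ?_ (norm_nonneg x)
  simpa [hT] using abs_real_inner_le_norm T x

theorem sinOfCos_sq {x : ℝ} (hx : |x| ≤ 1) : sinOfCos x ^ 2 = 1 - x ^ 2 :=
  sq_sqrt (sub_nonneg.2 ((sq_le_one_iff_abs_le_one x).2 hx))

theorem abs_inner_sub_le {T T' : E} (hT : ‖T‖ = 1) (hT' : ‖T'‖ = 1) {x : E} (hx : x ≠ 0) :
    |⟪T, T'⟫ - ⟪T, x⟫ / ‖x‖ * (⟪T', x⟫ / ‖x‖)| ≤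
      sinOfCos (⟪T, x⟫ / ‖x‖) * sinOfCos (⟪T', x⟫ / ‖x‖) := by
  obtain ⟨e, he⟩ : ∃ e, e = ‖x‖⁻¹ • x := ⟨_, rfl⟩
  have he1 : ‖e‖ = 1 := he ▸ norm_smul_inv_norm hx
  have h : ∀ y : E, ⟪y, x⟫ / ‖x‖ = ⟪y, e⟫ := fun y => by
    rw [he, inner_smul_right, inv_mul_eq_div]
  rw [h, h, ← norm_sub_inner_smul hT he1, ← norm_sub_inner_smul hT' he1]
  convert abs_real_inner_le_norm (T - ⟪T, e⟫ • e) (T' - ⟪T', e⟫ • e) using 2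
  simp only [inner_sub_left, inner_sub_right, real_inner_smul_left, real_inner_smul_right,
    real_inner_self_eq_norm_sq, he1, real_inner_comm T' e]
  ring

theorem hasDerivAt_norm_of_ne_zero {d : ℝ → E} {d' : E} {w : ℝ} (hd : HasDerivAt d d' w)
    (h0 : d w ≠ 0) : HasDerivAt (fun s => ‖d s‖) (⟪d', d w⟫ / ‖d w‖) w := by
  have hpos : 0 < ‖d w‖ := norm_pos_iff.2 h0
  have h := hd.norm_sq.sqrt (by positivity)
  simp only [sqrt_sq (norm_nonneg _)] at h
  refine h.congr_deriv ?_
  rw [real_inner_comm]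
  field_simp

theorem hasDerivAt_inner_div_norm {d : ℝ → E} {d' T : E} {w : ℝ} (hd : HasDerivAt d d' w)
    (h0 : d w ≠ 0) : HasDerivAt (fun s => ⟪T, d s⟫ / ‖d s‖)
      ((⟪T, d'⟫ - ⟪T, d w⟫ / ‖d w‖ * (⟪d', d w⟫ / ‖d w‖)) / ‖d w‖) w := by
  have hpos : 0 < ‖d w‖ := norm_pos_iff.2 h0
  have h1 : HasDerivAt (fun s => ⟪T, d s⟫) ⟪T, d'⟫ w := by
    simpa using (hasDerivAt_const w T).inner ℝ hd
  refine (h1.div (hasDerivAt_norm_of_ne_zero hd h0) hpos.ne').congr_deriv ?_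
  field_simp

theorem tendsto_inner_div_norm_right {d : ℝ → E} {T : E} (hT : ‖T‖ = 1) (hd : HasDerivAt d T 0)
    (h0 : d 0 = 0) : Tendsto (fun w => ⟪T, d w⟫ / ‖d w‖) (𝓝[>] 0) (𝓝 1) := by
  have hc : ContinuousAt (fun x : E => ⟪T, x⟫ / ‖x‖) T :=
    ContinuousAt.div (by fun_prop) (by fun_prop) (by rw [hT]; exact one_ne_zero)
  have h1 := hc.tendsto.comp ((hasDerivAt_iff_tendsto_slope_left_right.1 hd).2)
  rw [real_inner_self_eq_norm_sq, hT] at h1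
  norm_num at h1
  refine h1.congr' ?_
  filter_upwards [self_mem_nhdsWithin] with w (hw : 0 < w)
  simp only [Function.comp_apply, slope, h0, vsub_eq_sub, sub_zero, inner_smul_right, norm_smul,
    norm_inv, norm_of_nonneg hw.le]
  rw [mul_div_mul_left _ _ (inv_ne_zero hw.ne')]

theorem tendsto_inner_div_norm_left {d : ℝ → E} {T : E} (hT : ‖T‖ = 1) (hd : HasDerivAt d T 0)
    (h0 : d 0 = 0) : Tendsto (fun w => ⟪T, d w⟫ / ‖d w‖) (𝓝[<] 0) (𝓝 (-1)) := by
  have hd' : HasDerivAt (fun w => -d (-w)) T 0 := by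
    have h := HasDerivAt.scomp (h := fun w : ℝ => -w) (h' := -1) 0 (by simpa using hd)
      (hasDerivAt_neg 0)
    simpa [Function.comp_def] using h.fun_neg
  have hneg : Tendsto (fun w : ℝ => -w) (𝓝[<] 0) (𝓝[>] 0) := by
    simpa using tendsto_neg_nhdsLT (a := (0 : ℝ))
  have h := (tendsto_inner_div_norm_right hT hd' (by simp [h0])).comp hneg
  refine h.neg.congr fun w => ?_
  simp [neg_div]

theorem exists_lipschitzOnWith_inner_div_norm {d : ℝ → E} {T : E} (hT : ‖T‖ = 1)
    (hd : LipschitzWith 1 d) (h0 : ∀ w ∈ Ioo (0 : ℝ) 1, d w ≠ 0) :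
    ∀ a b, 0 < a → b < 1 →
      ∃ K, LipschitzOnWith K (fun w => ⟪T, d w⟫ / ‖d w‖) (Icc a b) := by
  intro a b ha hb
  have hsub : Icc a b ⊆ Ioo 0 1 := fun w hw => ⟨ha.trans_le hw.1, hw.2.trans_lt hb⟩
  obtain ⟨m, hm0, hm⟩ : ∃ m > 0, ∀ w ∈ Icc a b, m ≤ ‖d w‖ :=
    isCompact_Icc.exists_forall_le' hd.continuous.norm.continuousOn
      fun w hw => norm_pos_iff.2 (h0 w (hsub hw))
  refine ⟨(2 / m).toNNReal, LipschitzOnWith.of_dist_le_mul fun x hx y hy => ?_⟩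
  rw [coe_toNNReal _ (by positivity), dist_eq_norm, norm_eq_abs]
  have hx0 := norm_pos_iff.2 (h0 x (hsub hx))
  have hy0 := norm_pos_iff.2 (h0 y (hsub hy))
  have hxy : ‖d x - d y‖ ≤ dist x y := by simpa [dist_eq_norm] using hd.dist_le_mul x y
  have h1 : |⟪T, d x - d y⟫| ≤ ‖d x - d y‖ := by
    simpa [hT] using abs_real_inner_le_norm T (d x - d y)
  have h2 : |⟪T, d y⟫| ≤ ‖d y‖ := by simpa [hT] using abs_real_inner_le_norm T (d y)
  have h3 : |‖d y‖ - ‖d x‖| ≤ ‖d x - d y‖ := by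
    rw [norm_sub_rev]
    exact abs_norm_sub_norm_le _ _
  have h4 : ⟪T, d x⟫ / ‖d x‖ - ⟪T, d y⟫ / ‖d y‖ =
      ⟪T, d x - d y⟫ / ‖d x‖ + ⟪T, d y⟫ / ‖d y‖ * ((‖d y‖ - ‖d x‖) / ‖d x‖) := by
    rw [inner_sub_right]
    field_simp
    ring
  rw [h4]
  calc _ ≤ |⟪T, d x - d y⟫| / ‖d x‖ + |⟪T, d y⟫ / ‖d y‖| * (|‖d y‖ - ‖d x‖| / ‖d x‖) := by
        refine (abs_add_le _ _).trans (le_of_eq ?_)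
        rw [abs_mul, abs_div _ ‖d x‖, abs_div _ ‖d x‖, abs_norm]
    _ ≤ ‖d x - d y‖ / ‖d x‖ + 1 * (‖d x - d y‖ / ‖d x‖) := by
        gcongr
        exact abs_inner_div_norm_le_one hT _
    _ = 2 * ‖d x - d y‖ / ‖d x‖ := by ring
    _ ≤ 2 * dist x y / m := by
        gcongr
        exact hm x hx
    _ = 2 / m * dist x y := by ring

end Chord

section Loop

variable {E : Type*} [NormedAddCommGroup E] [InnerProductSpace ℝ E]

def HasUnitDerivAt (f : ℝ → E) (t : ℝ) : Prop :=
  HasDerivAt f (deriv f t) t ∧ ‖deriv f t‖ = 1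

structure IsUnitSpeedLoop (f : ℝ → E) : Prop where
  lipschitz : LipschitzWith 1 f
  periodic : Function.Periodic f 1
  ne : ∀ u, ∀ w ∈ Ioo (0 : ℝ) 1, f (u + w) ≠ f u
  ae_hasDerivAt : ∀ᵐ t, HasUnitDerivAt f t

/-- The tangent-point integrand for `p = q + 1`, in terms of the angle between the tangent at `u`
and the secant through `u` and `v`. -/
def tpKernel (q : ℝ) (f : ℝ → E) (u v : ℝ) : ℝ≥0∞ :=
  ENNReal.ofReal (sinOfCos (⟪deriv f u, f v - f u⟫ / ‖f v - f u‖) ^ q / ‖f v - f u‖)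

def tpEnergy (q : ℝ) (f : ℝ → E) : ℝ≥0∞ :=
  ∫⁻ u in Ioc (0 : ℝ) 1, ∫⁻ v in Ioc (0 : ℝ) 1, tpKernel q f u v

/-- The cosine of the angle between `T` and the secant from `f u` to `f (u + w)`. -/
def secantCos (f : ℝ → E) (T : E) (u w : ℝ) : ℝ :=
  ⟪T, f (u + w) - f u⟫ / ‖f (u + w) - f u‖

/-- The contribution of the point `f u` to the energy, after symmetrisation in both end points of
the secants. -/
def tpDensity (q : ℝ) (f : ℝ → E) (u : ℝ) : ℝ≥0∞ :=
  ∫⁻ w in Ioo (0 : ℝ) 1, ENNReal.ofReal (symmIntegrand q ‖f (u + w) - f u‖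
    (secantCos f (deriv f u) u w) (secantCos f (deriv f (u + w)) u w))

theorem setLIntegral_Ioc_add_of_periodic {Φ : ℝ → ℝ≥0∞} (hΦ : Function.Periodic Φ 1)
    (u : ℝ) : ∫⁻ w in Ioc (0 : ℝ) 1, Φ (u + w) = ∫⁻ v in Ioc (0 : ℝ) 1, Φ v := by
  have h : ∫⁻ w in Ioc (0 : ℝ) 1, Φ (u + w) = ∫⁻ v in Ioc u (u + 1), Φ v := by
    have h := (measurePreserving_add_left volume u).setLIntegral_comp_preimage_emb
      (measurableEmbedding_addLeft u) Φ (Ioc u (u + 1))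
    rw [← h]
    simp
  have : Countable (AddSubgroup.zmultiples (1 : ℝ)) := inferInstance
  rw [h, (isAddFundamentalDomain_Ioc one_pos u volume).setLIntegral_eq
    (isAddFundamentalDomain_Ioc one_pos 0 volume) Φ, zero_add]
  rintro ⟨g, k, rfl⟩ x
  simpa [AddSubgroup.vadd_def, add_comm] using (hΦ.int_mul k) x

theorem deriv_periodic {f : ℝ → E} (hf : Function.Periodic f 1) :
    Function.Periodic (deriv f) 1 := fun x => by
  rw [← deriv_comp_add_const, hf.funext]

theorem tpKernel_periodic_left {f : ℝ → E} (hf : Function.Periodic f 1) (q v : ℝ) :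
    Function.Periodic (fun u => tpKernel q f u v) 1 := fun u => by
  simp only [tpKernel, hf u, deriv_periodic hf u]

theorem tpKernel_periodic_right {f : ℝ → E} (hf : Function.Periodic f 1) (q u : ℝ) :
    Function.Periodic (tpKernel q f u) 1 := fun v => by
  simp only [tpKernel, hf v]

theorem tpKernel_add (q : ℝ) (f : ℝ → E) (u w : ℝ) : tpKernel q f u (u + w) =
    ENNReal.ofReal (sinOfCos (secantCos f (deriv f u) u w) ^ q / ‖f (u + w) - f u‖) := rfl

theorem tpKernel_add_left (q : ℝ) (f : ℝ → E) (u w : ℝ) : tpKernel q f (u + w) u =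
    ENNReal.ofReal (sinOfCos (secantCos f (deriv f (u + w)) u w) ^ q /
      ‖f (u + w) - f u‖) := by
  rw [tpKernel, secantCos, norm_sub_rev (f u), ← neg_sub (f (u + w)), inner_neg_right, neg_div,
    sinOfCos_neg]

theorem ofReal_symmIntegrand {q : ℝ} (hq : 1 < q) (f : ℝ → E) (u w : ℝ) :
    ENNReal.ofReal (symmIntegrand q ‖f (u + w) - f u‖ (secantCos f (deriv f u) u w)
      (secantCos f (deriv f (u + w)) u w)) =
    ENNReal.ofReal q⁻¹ * tpKernel q f (u + w) u +
      ENNReal.ofReal (1 - q⁻¹) * tpKernel q f u (u + w) := by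
  have h1 : 0 ≤ 1 - q⁻¹ := sub_nonneg.2 (inv_le_one_of_one_le₀ hq.le)
  have h2 := sinOfCos_nonneg
  rw [tpKernel_add, tpKernel_add_left, ← ENNReal.ofReal_mul (by positivity),
    ← ENNReal.ofReal_mul h1, ← ENNReal.ofReal_add, symmIntegrand]
  · congr 1
    ring
  · have := h2 (secantCos f (deriv f (u + w)) u w)
    positivity
  · have := h2 (secantCos f (deriv f u) u w)
    positivity

variable [CompleteSpace E] [SecondCountableTopology E]

theorem measurable_secantCos {f : ℝ → E} (hf : Continuous f) :
    Measurable fun p : ℝ × ℝ => ⟪deriv f p.1, f p.2 - f p.1⟫ / ‖f p.2 - f p.1‖ := by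
  borelize E
  have h : Measurable f := hf.measurable
  have h1 : Measurable fun p : ℝ × ℝ => f p.2 - f p.1 :=
    (h.comp measurable_snd).sub (h.comp measurable_fst)
  exact (((measurable_deriv f).comp measurable_fst).inner h1).div h1.norm

theorem measurable_tpKernel {f : ℝ → E} (hf : Continuous f) (q : ℝ) :
    Measurable fun p : ℝ × ℝ => tpKernel q f p.1 p.2 := by
  borelize E
  have h : Measurable f := hf.measurable
  have h1 : Measurable fun p : ℝ × ℝ => f p.2 - f p.1 :=
    (h.comp measurable_snd).sub (h.comp measurable_fst)
  exact (((continuous_sinOfCos.measurable.comp (measurable_secantCos hf)).pow_const q).div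
    h1.norm).ennreal_ofReal

theorem tpDensity_eq {q : ℝ} (hq : 1 < q) {f : ℝ → E} (hf : Continuous f)
    (hp : Function.Periodic f 1) (u : ℝ) :
    tpDensity q f u = ENNReal.ofReal q⁻¹ * (∫⁻ v in Ioc (0 : ℝ) 1, tpKernel q f v u) +
      ENNReal.ofReal (1 - q⁻¹) * (∫⁻ v in Ioc (0 : ℝ) 1, tpKernel q f u v) := by
  have hm := measurable_tpKernel hf q
  have h1 : Measurable fun w => tpKernel q f (u + w) u :=
    hm.comp (f := fun w => (u + w, u)) (by fun_prop)
  have h2 : Measurable fun w => tpKernel q f u (u + w) :=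
    hm.comp (f := fun w => (u, u + w)) (by fun_prop)
  simp only [tpDensity, ofReal_symmIntegrand hq]
  rw [lintegral_add_left (h1.const_mul _), lintegral_const_mul _ h1, lintegral_const_mul _ h2,
    setLIntegral_congr Ioo_ae_eq_Ioc, setLIntegral_congr Ioo_ae_eq_Ioc,
    setLIntegral_Ioc_add_of_periodic (tpKernel_periodic_left hp q u) u,
    setLIntegral_Ioc_add_of_periodic (tpKernel_periodic_right hp q u) u]

theorem measurable_tpDensity {q : ℝ} (hq : 1 < q) {f : ℝ → E} (hf : Continuous f)
    (hp : Function.Periodic f 1) : Measurable (tpDensity q f) := by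
  have hm := measurable_tpKernel hf q
  rw [funext (tpDensity_eq hq hf hp)]
  exact ((hm.comp measurable_swap).lintegral_prod_right'
    (ν := volume.restrict (Ioc 0 1)) |>.const_mul _).add
    (hm.lintegral_prod_right' (ν := volume.restrict (Ioc 0 1)) |>.const_mul _)

theorem tpEnergy_eq_lintegral_tpDensity {q : ℝ} (hq : 1 < q) {f : ℝ → E} (hf : Continuous f)
    (hp : Function.Periodic f 1) :
    tpEnergy q f = ∫⁻ u in Ioc (0 : ℝ) 1, tpDensity q f u := by
  have hm := measurable_tpKernel hf q
  have hswap : ∫⁻ u in Ioc (0 : ℝ) 1, ∫⁻ v in Ioc (0 : ℝ) 1, tpKernel q f v u = tpEnergy q f :=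
    lintegral_lintegral_swap (hm.comp measurable_swap).aemeasurable
  have h1 : Measurable fun u => ∫⁻ v in Ioc (0 : ℝ) 1, tpKernel q f v u :=
    (hm.comp measurable_swap).lintegral_prod_right'
  have h2 : Measurable fun u => ∫⁻ v in Ioc (0 : ℝ) 1, tpKernel q f u v :=
    hm.lintegral_prod_right'
  have hq' : q⁻¹ ≤ 1 := inv_le_one_of_one_le₀ hq.le
  simp only [tpDensity_eq hq hf hp]
  rw [lintegral_add_left (h1.const_mul _), lintegral_const_mul _ h1, lintegral_const_mul _ h2,
    hswap, ← tpEnergy, ← add_mul, ← ENNReal.ofReal_add (by positivity) (sub_nonneg.2 hq'),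
    add_sub_cancel, ENNReal.ofReal_one, one_mul]

end Loop

section Density

variable {E : Type*} [NormedAddCommGroup E] [InnerProductSpace ℝ E]
  {f : ℝ → E} {u : ℝ} {q : ℝ}

/-- The derivative of `secantCos f (deriv f u) u` at `w`. -/
def secantCosDeriv (f : ℝ → E) (u w : ℝ) : ℝ :=
  (⟪deriv f u, deriv f (u + w)⟫ - secantCos f (deriv f u) u w *
    secantCos f (deriv f (u + w)) u w) / ‖f (u + w) - f u‖

/-- The equality case of the pointwise lower bound `ofReal_integral_sin_rpow_le_tpDensity`. -/
def IsOptimalAt (f : ℝ → E) (u : ℝ) : Prop :=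
  ∀ᵐ w, w ∈ Ioo (0 : ℝ) 1 →
    sinOfCos (secantCos f (deriv f (u + w)) u w) = sinOfCos (secantCos f (deriv f u) u w) ∧
    secantCosDeriv f u w * ‖f (u + w) - f u‖ = -sinOfCos (secantCos f (deriv f u) u w) ^ 2

theorem ae_add_left {P : ℝ → Prop} (h : ∀ᵐ t, P t) (u : ℝ) : ∀ᵐ w, P (u + w) :=
  (measurePreserving_add_left volume u).quasiMeasurePreserving.ae h

theorem HasDerivAt.add_sub {u w : ℝ} {f' : E} (h : HasDerivAt f f' (u + w)) :
    HasDerivAt (fun s => f (u + s) - f u) f' w :=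
  (h.comp_const_add u w).sub_const _

namespace IsUnitSpeedLoop

theorem sub_ne_zero (hf : IsUnitSpeedLoop f) (u : ℝ) {w : ℝ} (hw : w ∈ Ioo (0 : ℝ) 1) :
    f (u + w) - f u ≠ 0 := sub_ne_zero_of_ne (hf.ne u w hw)

theorem lipschitzWith_add_sub (hf : IsUnitSpeedLoop f) (u : ℝ) :
    LipschitzWith 1 fun w => f (u + w) - f u := by
  refine LipschitzWith.of_dist_le_mul fun x y => ?_
  simpa using hf.lipschitz.dist_le_mul (u + x) (u + y)

theorem continuous_norm_add_sub (hf : IsUnitSpeedLoop f) (u : ℝ) :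
    Continuous fun w => ‖f (u + w) - f u‖ :=
  (hf.lipschitzWith_add_sub u).continuous.norm

theorem tendsto_norm_add_sub_zero (hf : IsUnitSpeedLoop f) (u : ℝ) :
    Tendsto (fun w => ‖f (u + w) - f u‖) (𝓝[>] 0) (𝓝 0) := by
  simpa using ((hf.continuous_norm_add_sub u).tendsto 0).mono_left nhdsWithin_le_nhds

theorem tendsto_norm_add_sub_one (hf : IsUnitSpeedLoop f) (u : ℝ) :
    Tendsto (fun w => ‖f (u + w) - f u‖) (𝓝[<] 1) (𝓝 0) := by
  simpa [hf.periodic u] using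
    ((hf.continuous_norm_add_sub u).tendsto 1).mono_left nhdsWithin_le_nhds

theorem tendsto_secantCos_zero (hu : HasUnitDerivAt f u) :
    Tendsto (secantCos f (deriv f u) u) (𝓝[>] 0) (𝓝 1) :=
  tendsto_inner_div_norm_right hu.2 (HasDerivAt.add_sub (by simpa using hu.1)) (by simp)

theorem tendsto_secantCos_one (hf : IsUnitSpeedLoop f) (hu : HasUnitDerivAt f u) :
    Tendsto (secantCos f (deriv f u) u) (𝓝[<] 1) (𝓝 (-1)) := by
  have h1 : Tendsto (fun w : ℝ => w - 1) (𝓝[<] 1) (𝓝[<] 0) := by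
    refine tendsto_nhdsWithin_iff.2 ⟨?_, ?_⟩
    · exact Tendsto.mono_left (Continuous.tendsto' (by fun_prop) _ _ (by simp))
        nhdsWithin_le_nhds
    · filter_upwards [self_mem_nhdsWithin] with w (hw : w < 1) using sub_neg.2 hw
  refine ((tendsto_inner_div_norm_left hu.2 (HasDerivAt.add_sub (f := f) (u := u)
    (by simpa using hu.1)) (by simp)).comp h1).congr fun w => ?_
  have h2 : f (u + (w - 1)) = f (u + w) := by
    rw [← hf.periodic, add_assoc, sub_add_cancel]
  rw [Function.comp_apply, h2, secantCos]

theorem exists_lipschitzOnWith_secantCos (hf : IsUnitSpeedLoop f) (hu : HasUnitDerivAt f u) :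
    ∀ a b, 0 < a → b < 1 →
      ∃ K, LipschitzOnWith K (secantCos f (deriv f u) u) (Icc a b) :=
  exists_lipschitzOnWith_inner_div_norm hu.2 (hf.lipschitzWith_add_sub u)
    fun _ => hf.sub_ne_zero u

theorem hasDerivAt_secantCos (hf : IsUnitSpeedLoop f) {w : ℝ} (hw : w ∈ Ioo (0 : ℝ) 1)
    (h : HasUnitDerivAt f (u + w)) :
    HasDerivAt (secantCos f (deriv f u) u) (secantCosDeriv f u w) w :=
  hasDerivAt_inner_div_norm h.1.add_sub (hf.sub_ne_zero u hw)

theorem hasDerivAt_norm_add_sub (hf : IsUnitSpeedLoop f) {w : ℝ} (hw : w ∈ Ioo (0 : ℝ) 1)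
    (h : HasUnitDerivAt f (u + w)) :
    HasDerivAt (fun w => ‖f (u + w) - f u‖) (secantCos f (deriv f (u + w)) u w) w :=
  hasDerivAt_norm_of_ne_zero h.1.add_sub (hf.sub_ne_zero u hw)

variable [CompleteSpace E] [SecondCountableTopology E]

theorem ofReal_integral_sin_rpow_le_tpDensity (hf : IsUnitSpeedLoop f) (hq : 1 < q)
    (hu : HasUnitDerivAt f u) :
    ENNReal.ofReal (∫ θ in (0 : ℝ)..π, sin θ ^ (q - 1)) ≤ tpDensity q f u ∧
      (tpDensity q f u = ENNReal.ofReal (∫ θ in (0 : ℝ)..π, sin θ ^ (q - 1)) →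
        IsOptimalAt f u) := by
  have hae := ae_add_left hf.ae_hasDerivAt u
  refine lintegral_symmIntegrand hq (fun w hw => norm_pos_iff.2 (hf.sub_ne_zero u hw))
    (hf.continuous_norm_add_sub u).continuousOn ?_ (hf.exists_lipschitzOnWith_secantCos hu)
    (hae.mono fun w h hw => hf.hasDerivAt_secantCos hw h) ?_ (tendsto_secantCos_zero hu)
    (hf.tendsto_secantCos_one hu)
  · have h := ((measurable_secantCos hf.lipschitz.continuous).comp
      (f := fun w => (u + w, u)) (by fun_prop)).neg
    refine h.aemeasurable.congr (ae_of_all _ fun w => ?_)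
    simp only [Pi.neg_apply, Function.comp_apply]
    rw [secantCos, norm_sub_rev (f u), ← neg_sub (f (u + w)), inner_neg_right, neg_div, neg_neg]
  · filter_upwards [hae] with w h hw
    have h0 := norm_pos_iff.2 (hf.sub_ne_zero u hw)
    rw [secantCosDeriv, abs_div, abs_norm, div_mul_cancel₀ _ h0.ne']
    exact abs_inner_sub_le hu.2 h.2 (hf.sub_ne_zero u hw)

theorem ofReal_integral_sin_rpow_le_tpEnergy (hf : IsUnitSpeedLoop f) (hq : 1 < q) :
    ENNReal.ofReal (∫ θ in (0 : ℝ)..π, sin θ ^ (q - 1)) ≤ tpEnergy q f := by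
  rw [tpEnergy_eq_lintegral_tpDensity hq hf.lipschitz.continuous hf.periodic]
  calc _ = ∫⁻ _ in Ioc (0 : ℝ) 1, ENNReal.ofReal (∫ θ in (0 : ℝ)..π, sin θ ^ (q - 1)) := by
        simp
    _ ≤ _ := lintegral_mono_ae (ae_restrict_of_ae (hf.ae_hasDerivAt.mono fun u hu =>
        (hf.ofReal_integral_sin_rpow_le_tpDensity hq hu).1))

theorem ae_isOptimalAt_of_tpEnergy_eq (hf : IsUnitSpeedLoop f) (hq : 1 < q)
    (h : tpEnergy q f = ENNReal.ofReal (∫ θ in (0 : ℝ)..π, sin θ ^ (q - 1))) :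
    ∀ᵐ u, u ∈ Ioc (0 : ℝ) 1 → IsOptimalAt f u := by
  rw [tpEnergy_eq_lintegral_tpDensity hq hf.lipschitz.continuous hf.periodic] at h
  have heq : (fun _ => ENNReal.ofReal (∫ θ in (0 : ℝ)..π, sin θ ^ (q - 1)))
      =ᵐ[volume.restrict (Ioc (0 : ℝ) 1)] tpDensity q f := by
    refine ae_eq_of_ae_le_of_lintegral_le (ae_restrict_of_ae (hf.ae_hasDerivAt.mono fun u hu =>
        (hf.ofReal_integral_sin_rpow_le_tpDensity hq hu).1)) (by simp)
      (measurable_tpDensity hq hf.lipschitz.continuous hf.periodic).aemeasurable ?_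
    simp [h]
  filter_upwards [(ae_restrict_iff' measurableSet_Ioc).1 heq, hf.ae_hasDerivAt] with u h1 h2 hu
  exact (hf.ofReal_integral_sin_rpow_le_tpDensity hq h2).2 (h1 hu).symm

end IsUnitSpeedLoop

end Density

section Optimal

variable {E : Type*} [NormedAddCommGroup E] [InnerProductSpace ℝ E]
  {f : ℝ → E} {u : ℝ}

theorem ae_of_periodic {P : ℝ → Prop} (hP : Function.Periodic P 1) (a : ℝ)
    (h : ∀ᵐ t, t ∈ Ioo a (a + 1) → P t) : ∀ᵐ t, P t := by
  have h1 : ∀ᵐ t, t ∈ Ioc a (a + 1) → P t := by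
    filter_upwards [h, compl_mem_ae_iff.2 (measure_singleton (a + 1))] with t h1 h2 h3
    exact h1 ⟨h3.1, lt_of_le_of_ne h3.2 h2⟩
  have h2 : ∀ᵐ t, ∀ k : ℤ, (k : ℝ) + t ∈ Ioc a (a + 1) → P (k + t) :=
    ae_all_iff.2 fun k => ae_add_left h1 k
  filter_upwards [h2] with t ht
  obtain ⟨k, hk, -⟩ := existsUnique_add_zsmul_mem_Ioc one_pos t a
  have h3 := ht k (by simpa [add_comm] using hk)
  rwa [add_comm, show P (t + k) = P t by simpa using hP.int_mul k t] at h3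

theorem abs_secantCos_le_one {T : E} (hT : ‖T‖ = 1) (u w : ℝ) : |secantCos f T u w| ≤ 1 :=
  abs_inner_div_norm_le_one hT _

namespace IsUnitSpeedLoop

theorem hasDerivAt_secantCos_of_ae (hf : IsUnitSpeedLoop f) (hu : HasUnitDerivAt f u)
    (h : ∀ᵐ w, w ∈ Ioo (0 : ℝ) 1 → secantCosDeriv f u w * ‖f (u + w) - f u‖ =
      -sinOfCos (secantCos f (deriv f u) u w) ^ 2) :
    ∀ w ∈ Ioo (0 : ℝ) 1, HasDerivAt (secantCos f (deriv f u) u)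
      (-(1 - secantCos f (deriv f u) u w ^ 2) / ‖f (u + w) - f u‖) w := by
  intro w hw
  have hlip := hf.exists_lipschitzOnWith_secantCos hu
  have hcont := continuousOn_of_exists_lipschitzOnWith hlip
  refine hasDerivAt_of_ae_hasDerivAt
    (k := fun w => -(1 - secantCos f (deriv f u) u w ^ 2) / ‖f (u + w) - f u‖) ?_ hlip ?_ hw
  · exact ((continuousOn_const.sub (hcont.pow 2)).neg).div
      (hf.continuous_norm_add_sub u).continuousOn
      fun w hw => norm_ne_zero_iff.2 (hf.sub_ne_zero u hw)
  · filter_upwards [h, ae_add_left hf.ae_hasDerivAt u] with w h1 h2 hw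
    refine (hf.hasDerivAt_secantCos hw h2).congr_deriv ?_
    rw [eq_div_iff (norm_ne_zero_iff.2 (hf.sub_ne_zero u hw)), h1 hw,
      sinOfCos_sq (abs_secantCos_le_one hu.2 u w)]

theorem secantCos_sq_lt_one (hf : IsUnitSpeedLoop f) (hu : HasUnitDerivAt f u)
    (hd : ∀ w ∈ Ioo (0 : ℝ) 1, HasDerivAt (secantCos f (deriv f u) u)
      (-(1 - secantCos f (deriv f u) u w ^ 2) / ‖f (u + w) - f u‖) w)
    {w : ℝ} (hw : w ∈ Ioo (0 : ℝ) 1) : secantCos f (deriv f u) u w ^ 2 < 1 := by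
  have hcont : ContinuousOn (secantCos f (deriv f u) u) (Ioo 0 1) :=
    fun w hw => (hd w hw).continuousAt.continuousWithinAt
  have hc := (hf.continuous_norm_add_sub u).continuousOn (s := Ioo 0 1)
  have hc0 : ∀ w ∈ Ioo (0 : ℝ) 1, ‖f (u + w) - f u‖ ≠ 0 :=
    fun w hw => norm_ne_zero_iff.2 (hf.sub_ne_zero u hw)
  have hle := abs_secantCos_le_one (f := f) hu.2 u w
  refine lt_of_le_of_ne ((sq_le_one_iff_abs_le_one _).2 hle) fun h => ?_
  rcases sq_eq_sq_iff_eq_or_eq_neg.1 (h.trans (one_pow 2).symm) with h | h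
  · have h1 : ∀ t ∈ Ioo (0 : ℝ) 1, 1 - secantCos f (deriv f u) u t = 0 := fun t ht =>
      eq_zero_of_hasDerivAt_mul (h := fun t => 1 - secantCos f (deriv f u) u t)
        (m := fun t => (1 + secantCos f (deriv f u) u t) / ‖f (u + t) - f u‖)
        ((continuousOn_const.add hcont).div hc hc0)
        (fun t ht => ((hd t ht).const_sub 1).congr_deriv (by ring)) hw ht (sub_eq_zero.2 h.symm)
    have h2 : Tendsto (secantCos f (deriv f u) u) (𝓝[<] 1) (𝓝 1) :=
      tendsto_const_nhds.congr' <| by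
        filter_upwards [Ioo_mem_nhdsLT one_pos] with t ht using sub_eq_zero.1 (h1 t ht)
    have := tendsto_nhds_unique h2 (hf.tendsto_secantCos_one hu)
    norm_num at this
  · have h1 : ∀ t ∈ Ioo (0 : ℝ) 1, 1 + secantCos f (deriv f u) u t = 0 := fun t ht =>
      eq_zero_of_hasDerivAt_mul (h := fun t => 1 + secantCos f (deriv f u) u t)
        (m := fun t => -(1 - secantCos f (deriv f u) u t) / ‖f (u + t) - f u‖)
        ((continuousOn_const.sub hcont).neg.div hc hc0)
        (fun t ht => ((hd t ht).const_add 1).congr_deriv (by ring)) hw ht (by rw [h]; ring)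
    have h2 : Tendsto (secantCos f (deriv f u) u) (𝓝[>] 0) (𝓝 (-1)) :=
      tendsto_const_nhds.congr' <| by
        filter_upwards [Ioo_mem_nhdsGT one_pos] with t ht
        linarith [h1 t ht]
    have := tendsto_nhds_unique h2 (tendsto_secantCos_zero hu)
    norm_num at this

theorem norm_add_sub_eq_sin (hf : IsUnitSpeedLoop f) (hu : HasUnitDerivAt f u)
    (hd : ∀ w ∈ Ioo (0 : ℝ) 1, HasDerivAt (secantCos f (deriv f u) u)
      (-(1 - secantCos f (deriv f u) u w ^ 2) / ‖f (u + w) - f u‖) w)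
    (he : ∀ᵐ w, w ∈ Ioo (0 : ℝ) 1 →
      secantCos f (deriv f (u + w)) u w = secantCos f (deriv f u) u w)
    {w : ℝ} (hw : w ∈ Ioo (0 : ℝ) 1) :
    ‖f (u + w) - f u‖ = sin (π * w) / π ∧ secantCos f (deriv f u) u w = cos (π * w) := by
  refine chord_eq_sin_of_ode (c := fun w => ‖f (u + w) - f u‖)
    (fun w hw => norm_pos_iff.2 (hf.sub_ne_zero u hw))
    (fun w hw => hf.secantCos_sq_lt_one hu hd hw) (fun w hw => ?_) hd
    (hf.tendsto_norm_add_sub_zero u) (tendsto_secantCos_zero hu)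
    (hf.tendsto_norm_add_sub_one u) hw
  refine hasDerivAt_of_ae_hasDerivAt (k := secantCos f (deriv f u) u)
    (fun w hw => (hd w hw).continuousAt.continuousWithinAt)
    (fun a b _ _ => ⟨1, (lipschitzWith_one_norm.comp
      (hf.lipschitzWith_add_sub u)).lipschitzOnWith.weaken (by simp)⟩) ?_ hw
  filter_upwards [he, ae_add_left hf.ae_hasDerivAt u] with w h1 h2 hw
  exact (hf.hasDerivAt_norm_add_sub hw h2).congr_deriv (h1 hw)

theorem ae_deriv_ne_of_isOptimalAt (hf : IsUnitSpeedLoop f) (hu : HasUnitDerivAt f u)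
    (ho : IsOptimalAt f u) : ∀ᵐ t, deriv f t ≠ deriv f u := by
  have hd := hf.hasDerivAt_secantCos_of_ae hu (ho.mono fun w h hw => (h hw).2)
  refine ae_of_periodic (fun t => by simp only [deriv_periodic hf.periodic t]) u ?_
  have h := ae_add_left ho (-u)
  filter_upwards [h] with t ht htu heq
  have hw : -u + t ∈ Ioo (0 : ℝ) 1 := ⟨by linarith [htu.1], by linarith [htu.2]⟩
  have h1 := (ht hw).2
  have h2 := hf.secantCos_sq_lt_one hu hd hw
  have h3 : u + (-u + t) = t := by ring
  rw [secantCosDeriv, div_mul_cancel₀ _ (norm_ne_zero_iff.2 (hf.sub_ne_zero u hw)),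
    sinOfCos_sq (abs_secantCos_le_one hu.2 u _), h3, heq, real_inner_self_eq_norm_sq, hu.2] at h1
  nlinarith

theorem ae_deriv_ne (hf : IsUnitSpeedLoop f)
    (ho : ∀ᵐ u, u ∈ Ioc (0 : ℝ) 1 → IsOptimalAt f u) (e : E) : ∀ᵐ t, deriv f t ≠ e := by
  by_cases h : ∃ u, IsOptimalAt f u ∧ HasUnitDerivAt f u ∧ deriv f u = e
  · obtain ⟨u, h1, h2, rfl⟩ := h
    exact hf.ae_deriv_ne_of_isOptimalAt h2 h1
  · refine ae_of_periodic (fun t => by simp only [deriv_periodic hf.periodic t]) 0 ?_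
    filter_upwards [ho, hf.ae_hasDerivAt] with t h1 h2 ht he
    exact h ⟨t, h1 ⟨ht.1, by linarith [ht.2]⟩, h2, he⟩

theorem norm_add_sub_eq_sin_of_isOptimalAt (hf : IsUnitSpeedLoop f)
    (hne : ∀ᵐ t, deriv f t ≠ -deriv f u) (hu : HasUnitDerivAt f u) (ho : IsOptimalAt f u)
    {w : ℝ} (hw : w ∈ Ioo (0 : ℝ) 1) : ‖f (u + w) - f u‖ = sin (π * w) / π := by
  have hd := hf.hasDerivAt_secantCos_of_ae hu (ho.mono fun w h hw => (h hw).2)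
  refine (hf.norm_add_sub_eq_sin hu hd ?_ hw).1
  filter_upwards [ho, ae_add_left hne u, ae_add_left hf.ae_hasDerivAt u] with w h1 h2 h3 hw
  obtain ⟨h4, h5⟩ := h1 hw
  have h6 : secantCos f (deriv f (u + w)) u w ^ 2 = secantCos f (deriv f u) u w ^ 2 := by
    have h7 := congrArg (· ^ 2) h4
    simp only [sinOfCos_sq (abs_secantCos_le_one hu.2 u w),
      sinOfCos_sq (abs_secantCos_le_one h3.2 u w)] at h7
    linarith
  refine (sq_eq_sq_iff_eq_or_eq_neg.1 h6).resolve_right fun h8 => h2 ?_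
  rw [secantCosDeriv, div_mul_cancel₀ _ (norm_ne_zero_iff.2 (hf.sub_ne_zero u hw)),
    sinOfCos_sq (abs_secantCos_le_one hu.2 u _), h8] at h5
  exact (neg_eq_iff_eq_neg.2
    ((inner_eq_neg_one_iff_of_norm_eq_one (𝕜 := ℝ) hu.2 h3.2).1 (by linarith))).symm

theorem norm_add_sub_eq_abs_sin (hf : IsUnitSpeedLoop f)
    (ho : ∀ᵐ u, u ∈ Ioc (0 : ℝ) 1 → IsOptimalAt f u) (u w : ℝ) :
    ‖f (u + w) - f u‖ = |sin (π * w)| / π := by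
  have h1 : ∀ᵐ u, ∀ w ∈ Ioo (0 : ℝ) 1, ‖f (u + w) - f u‖ = sin (π * w) / π := by
    refine ae_of_periodic (fun u => ?_) 0 ?_
    · simp only [hf.periodic u, add_right_comm u 1, hf.periodic (u + _)]
    · filter_upwards [ho, hf.ae_hasDerivAt] with u h1 h2 h3 w hw
      exact hf.norm_add_sub_eq_sin_of_isOptimalAt (hf.ae_deriv_ne ho _) h2
        (h1 ⟨h3.1, by linarith [h3.2]⟩) hw
  have hcont := hf.lipschitz.continuous
  have h2 : ∀ w ∈ Ioo (0 : ℝ) 1, ∀ u, ‖f (u + w) - f u‖ = sin (π * w) / π := fun w hw u =>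
    congrFun (Continuous.ext_on (Measure.dense_of_ae (h1.mono fun u h => h w hw)) (by fun_prop)
      continuous_const fun u h => h) u
  have hw : w = Int.fract w + ⌊w⌋ := (Int.fract_add_floor w).symm
  have h3 : f (u + w) = f (u + Int.fract w) := by
    conv_lhs => rw [hw, ← add_assoc]
    simpa using hf.periodic.int_mul ⌊w⌋ (u + Int.fract w)
  have h4 : |sin (π * w)| = sin (π * Int.fract w) := by
    have h5 : 0 ≤ sin (π * Int.fract w) := by
      apply sin_nonneg_of_nonneg_of_le_pi
      · have := Int.fract_nonneg w
        positivity
      · nlinarith [pi_pos, Int.fract_lt_one w]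
    conv_lhs => rw [hw, mul_add, mul_comm π (⌊w⌋ : ℝ), sin_add_int_mul_pi]
    rw [abs_mul, abs_of_nonneg h5]
    simp
  rw [h3, h4]
  rcases (Int.fract_nonneg w).eq_or_lt with h5 | h5
  · simp [← h5]
  · exact h2 _ ⟨h5, Int.fract_lt_one w⟩ u

end IsUnitSpeedLoop

end Optimal

section Circle

variable {E : Type*} [NormedAddCommGroup E] [InnerProductSpace ℝ E] {f : ℝ → E}

theorem exists_cos_sin_eq {α β : ℝ} (h : α ^ 2 + β ^ 2 = 1) : ∃ θ : ℝ, cos θ = α ∧ sin θ = β := by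
  have h1 : ‖(⟨α, β⟩ : ℂ)‖ = 1 := by
    rw [Complex.norm_eq_sqrt_sq_add_sq, h, sqrt_one]
  refine ⟨Complex.arg ⟨α, β⟩, ?_, ?_⟩
  · rw [Complex.cos_arg (norm_ne_zero_iff.1 (by rw [h1]; exact one_ne_zero)), h1, div_one]
  · rw [Complex.sin_arg, h1, div_one]

theorem linearIndependent_pair_of_inner_eq_zero {a b : E} (ha : a ≠ 0) (hb : b ≠ 0)
    (hab : ⟪a, b⟫ = 0) : LinearIndependent ℝ ![a, b] := by
  refine linearIndependent_of_ne_zero_of_inner_eq_zero (𝕜 := ℝ) ?_ ?_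
  · intro i
    fin_cases i <;> simpa
  · intro i j hij
    fin_cases i <;> fin_cases j <;> simp_all [real_inner_comm]

theorem finrank_span_pair_of_inner_eq_zero {a b : E} (ha : a ≠ 0) (hb : b ≠ 0)
    (hab : ⟪a, b⟫ = 0) : Module.finrank ℝ (Submodule.span ℝ {a, b}) = 2 := by
  have h := finrank_span_eq_card (linearIndependent_pair_of_inner_eq_zero ha hb hab)
  rwa [Matrix.range_cons_cons_empty, Fintype.card_fin] at h

theorem norm_smul_add_smul_sq {a b : E} (hab : ⟪a, b⟫ = 0) (α β : ℝ) :
    ‖α • a + β • b‖ ^ 2 = α ^ 2 * ‖a‖ ^ 2 + β ^ 2 * ‖b‖ ^ 2 := by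
  rw [norm_add_sq_real, real_inner_smul_left, real_inner_smul_right, hab, norm_smul, norm_smul,
    mul_pow, mul_pow, norm_eq_abs, norm_eq_abs, sq_abs, sq_abs]
  ring

theorem isCircle_range_cos_add_sin {c a b : E} {r : ℝ} (hr : 0 < r) (ha : ‖a‖ = r)
    (hb : ‖b‖ = r) (hab : ⟪a, b⟫ = 0) :
    IsCircle (range fun θ : ℝ => c + (cos θ • a + sin θ • b)) := by
  have hnorm : ∀ α β : ℝ, ‖α • a + β • b‖ ^ 2 = (α ^ 2 + β ^ 2) * r ^ 2 := fun α β => by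
    rw [norm_smul_add_smul_sq hab, ha, hb]
    ring
  refine ⟨c, r, Submodule.span ℝ {a, b}, hr, ?_, ?_⟩
  · exact finrank_span_pair_of_inner_eq_zero
      (norm_pos_iff.1 (ha ▸ hr)) (norm_pos_iff.1 (hb ▸ hr)) hab
  · ext x
    constructor
    · rintro ⟨θ, rfl⟩
      simp only [add_sub_cancel_left, mem_ofPred_eq, Submodule.mem_span_pair]
      refine ⟨?_, cos θ, sin θ, rfl⟩
      rw [← sq_eq_sq₀ (norm_nonneg _) hr.le, hnorm, cos_sq_add_sin_sq, one_mul]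
    · rintro ⟨hx, hxV⟩
      obtain ⟨α, β, h⟩ := Submodule.mem_span_pair.1 hxV
      have h1 := hnorm α β
      rw [h, hx] at h1
      obtain ⟨θ, rfl, rfl⟩ := exists_cos_sin_eq
        (mul_right_cancel₀ (pow_pos hr 2).ne' (h1.symm.trans (one_mul _).symm))
      exact ⟨θ, by simp only [h, add_sub_cancel]⟩

theorem isCircle_range_of_norm_add_sub_eq
    (h : ∀ u w, ‖f (u + w) - f u‖ = |sin (π * w)| / π) : IsCircle (range f) := by
  have hd : ∀ s t, ‖f s - f t‖ ^ 2 = (1 - cos (2 * π * (s - t))) / (2 * π ^ 2) := fun s t => by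
    have h1 := h t (s - t)
    rw [add_sub_cancel] at h1
    rw [h1, div_pow, sq_abs, sin_sq_eq_half_sub, ← mul_assoc]
    field_simp
  obtain ⟨c, hc⟩ : ∃ c, c = (1 / 2 : ℝ) • (f 0 + f (1 / 2)) := ⟨_, rfl⟩
  have h0 : ∀ s, f s - c = (1 / 2 : ℝ) • ((f s - f 0) + (f s - f (1 / 2))) := fun s => by
    rw [hc]
    module
  have hpol : ∀ x y : E, ⟪x, y⟫ = (‖x‖ ^ 2 + ‖y‖ ^ 2 - ‖x - y‖ ^ 2) / 2 := fun x y => by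
    rw [norm_sub_sq_real]
    ring
  have hcos : ∀ s, cos (2 * π * (s - 1 / 2)) = -cos (2 * π * s) := fun s => by
    rw [← cos_sub_pi]
    congr 1
    ring
  have hn : ∀ s, ‖f s - c‖ ^ 2 = 1 / (4 * π ^ 2) := fun s => by
    rw [h0, norm_smul, mul_pow, norm_add_sq_real, hpol (f s - f 0), sub_sub_sub_cancel_left,
      hd, hd, hd, hcos, sub_zero, sub_zero, show 2 * π * (1 / 2) = π by ring, cos_pi]
    norm_num
    field_simp
    ring
  have hi : ∀ s t, ⟪f s - c, f t - c⟫ = cos (2 * π * (s - t)) / (4 * π ^ 2) := fun s t => by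
    rw [hpol, sub_sub_sub_cancel_right, hn, hn, hd]
    field_simp
    ring
  have hnorm : ∀ s, ‖f s - c‖ = 1 / (2 * π) := fun s => by
    rw [← sq_eq_sq₀ (norm_nonneg _) (by positivity), hn]
    ring
  have hquarter : ∀ s, cos (2 * π * (s - 1 / 4)) = sin (2 * π * s) := fun s => by
    rw [← cos_sub_pi_div_two]
    congr 1
    ring
  have hab : ⟪f 0 - c, f (1 / 4) - c⟫ = 0 := by
    rw [hi, hquarter]
    simp
  have hf : ∀ t, f t = c + (cos (2 * π * t) • (f 0 - c) + sin (2 * π * t) • (f (1 / 4) - c)) := by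
    intro t
    rw [← sub_eq_iff_eq_add', ← sub_eq_zero, ← norm_eq_zero, ← sq_eq_zero_iff, norm_sub_sq_real,
      norm_smul_add_smul_sq hab, inner_add_right, inner_smul_right, inner_smul_right, hi, hi,
      hquarter, hn, hn, hn, sub_zero]
    have h1 := cos_sq_add_sin_sq (2 * π * t)
    generalize cos (2 * π * t) = x at h1 ⊢
    generalize sin (2 * π * t) = y at h1 ⊢
    field_simp
    linear_combination (-1) * h1
  have hrange : range f = range fun θ : ℝ => c + (cos θ • (f 0 - c) + sin θ • (f (1 / 4) - c)) := by
    ext x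
    constructor
    · rintro ⟨t, rfl⟩
      exact ⟨2 * π * t, (hf t).symm⟩
    · rintro ⟨θ, rfl⟩
      refine ⟨θ / (2 * π), ?_⟩
      rw [hf, mul_div_cancel₀ _ (by positivity)]
  rw [hrange]
  exact isCircle_range_cos_add_sin (by positivity) (hnorm _) (hnorm _) hab

end Circle

section CircleEnergy

variable {E : Type*} [NormedAddCommGroup E] [InnerProductSpace ℝ E]

theorem exists_eq_smul_add_smul {V : Submodule ℝ E} (hV : Module.finrank ℝ V = 2) {a b x : E}
    (haV : a ∈ V) (hbV : b ∈ V) (ha : a ≠ 0) (hb : b ≠ 0) (hab : ⟪a, b⟫ = 0) (hx : x ∈ V) :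
    ∃ α β : ℝ, x = α • a + β • b := by
  have : Module.Finite ℝ V := Module.finite_of_finrank_pos (by lia)
  have h := (finrank_span_pair_of_inner_eq_zero ha hb hab).trans hV.symm
  have hle : Submodule.span ℝ {a, b} ≤ V :=
    Submodule.span_le.2 (insert_subset haV (singleton_subset_iff.2 hbV))
  rw [← Submodule.eq_of_le_of_finrank_eq hle h, Submodule.mem_span_pair] at hx
  obtain ⟨α, β, h⟩ := hx
  exact ⟨α, β, h.symm⟩

section Secant

variable {V : Submodule ℝ E} {p p' T T' : E} {r : ℝ}

theorem exists_secant_coordinates (hV : Module.finrank ℝ V = 2) (hr : 0 < r)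
    (hp : ‖p‖ = r) (hpV : p ∈ V) (hT : ‖T‖ = 1) (hTV : T ∈ V) (hpT : ⟪p, T⟫ = 0)
    (hp' : ‖p'‖ = r) (hpV' : p' ∈ V) (hne : p' - p ≠ 0) :
    ∃ α m : ℝ, p' = α • p + m • T ∧ α ^ 2 * r ^ 2 + m ^ 2 = r ^ 2 ∧ α < 1 ∧
      ‖p' - p‖ ^ 2 = 2 * r ^ 2 * (1 - α) ∧ ⟪T, p' - p⟫ = m ∧
      (⟪T, p' - p⟫ / ‖p' - p‖) ^ 2 = (1 + α) / 2 := by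
  have hT0 : T ≠ 0 := norm_ne_zero_iff.1 (hT ▸ one_ne_zero)
  have hp0 : p ≠ 0 := norm_pos_iff.1 (hp ▸ hr)
  obtain ⟨α, m, h⟩ := exists_eq_smul_add_smul hV hpV hTV hp0 hT0 hpT hpV'
  have h1 : α ^ 2 * r ^ 2 + m ^ 2 = r ^ 2 := by
    have := norm_smul_add_smul_sq hpT α m
    rw [← h, hp, hp', hT] at this
    linarith
  have h2 : ‖p' - p‖ ^ 2 = 2 * r ^ 2 * (1 - α) := by
    have : p' - p = (α - 1) • p + m • T := by
      rw [h]
      module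
    rw [this, norm_smul_add_smul_sq hpT, hp, hT]
    linear_combination h1
  have h3 : 0 < ‖p' - p‖ ^ 2 := pow_pos (norm_pos_iff.2 hne) 2
  have h4 : α < 1 := by
    rw [h2] at h3
    exact sub_pos.1 (pos_of_mul_pos_right h3 (by positivity))
  have h5 : ⟪T, p' - p⟫ = m := by
    rw [h, inner_sub_right, inner_add_right, inner_smul_right, inner_smul_right,
      real_inner_comm, hpT, real_inner_self_eq_norm_sq, hT]
    ring
  refine ⟨α, m, h, h1, h4, h2, h5, ?_⟩
  rw [div_pow, h5, div_eq_iff h3.ne', h2]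
  linear_combination h1

theorem secantCos_sq_lt_one_of_circle (hV : Module.finrank ℝ V = 2) (hr : 0 < r)
    (hp : ‖p‖ = r) (hpV : p ∈ V) (hT : ‖T‖ = 1) (hTV : T ∈ V) (hpT : ⟪p, T⟫ = 0)
    (hp' : ‖p'‖ = r) (hpV' : p' ∈ V) (hne : p' - p ≠ 0) :
    (⟪T, p' - p⟫ / ‖p' - p‖) ^ 2 < 1 := by
  obtain ⟨α, m, -, -, h1, -, -, h2⟩ :=
    exists_secant_coordinates hV hr hp hpV hT hTV hpT hp' hpV' hne
  rw [h2]
  linarith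

/-- A point of a circle is determined by the angle between the secant to a second point and the
tangent at that point. -/
theorem eq_of_secantCos (hV : Module.finrank ℝ V = 2) (hr : 0 < r)
    (hp : ‖p‖ = r) (hpV : p ∈ V) (hT : ‖T‖ = 1) (hTV : T ∈ V) (hpT : ⟪p, T⟫ = 0)
    (hp' : ‖p'‖ = r) (hpV' : p' ∈ V) (hne : p' - p ≠ 0) :
    p' = (2 * (⟪T, p' - p⟫ / ‖p' - p‖) ^ 2 - 1) • p +
      (⟪T, p' - p⟫ / ‖p' - p‖ * √(4 * r ^ 2 * (1 - (⟪T, p' - p⟫ / ‖p' - p‖) ^ 2))) • T := by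
  obtain ⟨α, m, h, h1, h2, h3, h4, h5⟩ :=
    exists_secant_coordinates hV hr hp hpV hT hTV hpT hp' hpV' hne
  have h6 : 4 * r ^ 2 * (1 - (⟪T, p' - p⟫ / ‖p' - p‖) ^ 2) = ‖p' - p‖ ^ 2 := by
    rw [h5, h3]
    ring
  rw [h6, sqrt_sq (norm_nonneg _), div_mul_cancel₀ _ (norm_ne_zero_iff.2 hne), h5, h4]
  convert h using 3
  ring

theorem secant_angles_of_circle (hV : Module.finrank ℝ V = 2) (hr : 0 < r)
    (hp : ‖p‖ = r) (hpV : p ∈ V) (hT : ‖T‖ = 1) (hTV : T ∈ V) (hpT : ⟪p, T⟫ = 0)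
    (hp' : ‖p'‖ = r) (hpV' : p' ∈ V) (hT' : ‖T'‖ = 1) (hTV' : T' ∈ V) (hpT' : ⟪p', T'⟫ = 0)
    (hne : p' - p ≠ 0) :
    (⟪T', p' - p⟫ = ⟪T, p' - p⟫ ∧
      ⟪T, T'⟫ - ⟪T, p' - p⟫ / ‖p' - p‖ * (⟪T', p' - p⟫ / ‖p' - p‖) =
        -(1 - (⟪T, p' - p⟫ / ‖p' - p‖) ^ 2)) ∨
      ⟪T, T'⟫ - ⟪T, p' - p⟫ / ‖p' - p‖ * (⟪T', p' - p⟫ / ‖p' - p‖) =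
        1 - (⟪T, p' - p⟫ / ‖p' - p‖) ^ 2 := by
  obtain ⟨α, m, h, h1, h2, h3, h4, h5⟩ :=
    exists_secant_coordinates hV hr hp hpV hT hTV hpT hp' hpV' hne
  have hT0 : T ≠ 0 := norm_ne_zero_iff.1 (hT ▸ one_ne_zero)
  have hp0 : p ≠ 0 := norm_pos_iff.1 (hp ▸ hr)
  obtain ⟨x, y, hxy⟩ := exists_eq_smul_add_smul hV hpV hTV hp0 hT0 hpT hTV'
  have hTp : ⟪T, p⟫ = 0 := by rw [real_inner_comm, hpT]
  have h6 : x ^ 2 * r ^ 2 + y ^ 2 = 1 := by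
    have := norm_smul_add_smul_sq hpT x y
    rw [← hxy, hp, hT', hT] at this
    linarith
  have h7 : α * x * r ^ 2 + m * y = 0 := by
    rw [h, hxy] at hpT'
    simp only [inner_add_left, inner_add_right, real_inner_smul_left, real_inner_smul_right, hpT,
      hTp, real_inner_self_eq_norm_sq, hp, hT] at hpT'
    linarith
  have h8 : ⟪T', p' - p⟫ = -(x * r ^ 2) := by
    rw [inner_sub_right, real_inner_comm, hpT', hxy, inner_add_left, real_inner_smul_left,
      real_inner_smul_left, hTp, real_inner_self_eq_norm_sq, hp]
    ring
  have h9 : ⟪T, T'⟫ = y := by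
    rw [hxy, inner_add_right, real_inner_smul_right, real_inner_smul_right, hTp,
      real_inner_self_eq_norm_sq, hT]
    ring
  obtain ⟨σ, hσ⟩ : ∃ σ, σ = y * α - x * m := ⟨_, rfl⟩
  have hr2 : r ^ 2 ≠ 0 := by positivity
  have hy : y = σ * α := by
    apply mul_right_cancel₀ hr2
    rw [hσ]
    linear_combination (-y) * h1 + m * h7
  have hx : x * r ^ 2 = -(σ * m) := by
    apply mul_right_cancel₀ hr2
    rw [hσ]
    linear_combination (-x * r ^ 2) * h1 + α * r ^ 2 * h7
  have hσ2 : σ ^ 2 = 1 := by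
    apply mul_right_cancel₀ hr2
    rw [hσ]
    linear_combination (α ^ 2 * r ^ 2 + m ^ 2) * h6 - (α * x * r ^ 2 + m * y) * h7 + h1
  have hs : ⟪T', p' - p⟫ = σ * ⟪T, p' - p⟫ := by rw [h8, hx, h4, neg_neg]
  rw [hs, mul_div_assoc, ← mul_assoc, mul_comm _ σ, mul_assoc, ← sq, h9, hy, h5]
  rcases sq_eq_sq_iff_eq_or_eq_neg.1 (hσ2.trans (one_pow 2).symm) with rfl | rfl
  · left
    constructor <;> ring
  · right
    ring

end Secant

theorem strictAntiOn_of_injOn_of_tendsto {g : ℝ → ℝ} {a b l r : ℝ} (hab : a < b)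
    (hg : ContinuousOn g (Ioo a b)) (hinj : InjOn g (Ioo a b)) (ha : Tendsto g (𝓝[>] a) (𝓝 l))
    (hb : Tendsto g (𝓝[<] b) (𝓝 r)) (hrl : r < l) : StrictAntiOn g (Ioo a b) := by
  refine (hg.strictMonoOn_of_injOn_Ioo hab hinj).resolve_left fun h => ?_
  obtain ⟨c, hc⟩ := exists_between hab
  have h1 : l ≤ g c := le_of_tendsto ha <| by
    filter_upwards [Ioo_mem_nhdsGT hc.1] with w hw
    exact (h ⟨hw.1, hw.2.trans hc.2⟩ hc hw.2).le
  have h2 : g c ≤ r := ge_of_tendsto hb <| by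
    filter_upwards [Ioo_mem_nhdsLT hc.2] with w hw
    exact (h hc ⟨hc.1.trans hw.1, hw.2⟩ hw.1).le
  linarith

namespace IsUnitSpeedLoop

variable {f : ℝ → E} {u : ℝ}

theorem injOn_add (hf : IsUnitSpeedLoop f) (u : ℝ) : InjOn (fun w => f (u + w)) (Ioo 0 1) := by
  have h : ∀ x ∈ Ioo (0 : ℝ) 1, ∀ y ∈ Ioo (0 : ℝ) 1, x < y → f (u + y) ≠ f (u + x) := by
    intro x hx y hy hxy
    have := hf.ne (u + x) (y - x) ⟨sub_pos.2 hxy, by linarith [hx.1, hy.2]⟩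
    rwa [add_assoc, add_sub_cancel] at this
  intro x hx y hy hxy
  rcases lt_trichotomy x y with h1 | h1 | h1
  · exact absurd hxy.symm (h x hx y hy h1)
  · exact h1
  · exact absurd hxy (h y hy x hx h1)

theorem norm_add_sub_eq_sin_of_isCircle (hf : IsUnitSpeedLoop f) (hu : HasUnitDerivAt f u)
    (hcirc : IsCircle (range f)) {w : ℝ} (hw : w ∈ Ioo (0 : ℝ) 1) :
    ‖f (u + w) - f u‖ = sin (π * w) / π ∧ secantCos f (deriv f u) u w = cos (π * w) := by
  obtain ⟨c, r, V, hr, hV, hrange⟩ := hcirc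
  have hmem : ∀ t, ‖f t - c‖ = r ∧ f t - c ∈ V := fun t => by
    have : f t ∈ range f := mem_range_self t
    rwa [hrange] at this
  have : Module.Finite ℝ V := Module.finite_of_finrank_pos (by lia)
  have hDV : ∀ t, deriv f t ∈ V := fun t => by
    have h1 := range_deriv_subset_closure_span_image (fun t => f t - c) dense_univ
      (mem_range_self t)
    rw [deriv_sub_const] at h1
    refine closure_minimal ?_ V.closed_of_finiteDimensional h1
    exact Submodule.span_le.2 (by rintro _ ⟨t, -, rfl⟩; exact (hmem t).2)
  have hperp : ∀ t, HasUnitDerivAt f t → ⟪f t - c, deriv f t⟫ = 0 := fun t ht => by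
    have h1 := (ht.1.sub_const c).norm_sq
    simp only [(hmem _).1] at h1
    have := h1.unique (hasDerivAt_const t _)
    linarith
  have hsub : ∀ w, f (u + w) - f u = (f (u + w) - c) - (f u - c) := fun w => by abel
  have hne : ∀ w ∈ Ioo (0 : ℝ) 1, (f (u + w) - c) - (f u - c) ≠ 0 := fun w hw => by
    rw [← hsub]
    exact hf.sub_ne_zero u hw
  have hinj : InjOn (secantCos f (deriv f u) u) (Ioo 0 1) := by
    intro x hx y hy hxy
    have key := fun w hw => eq_of_secantCos hV hr (hmem u).1 (hmem u).2 hu.2 (hDV u)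
      (hperp u hu) (hmem (u + w)).1 (hmem (u + w)).2 (hne w hw)
    have h1 := key x hx
    have h2 := key y hy
    rw [← hsub, ← secantCos] at h1 h2
    rw [hxy, ← h2] at h1
    exact hf.injOn_add u hx hy (sub_left_injective h1)
  have hlip := hf.exists_lipschitzOnWith_secantCos hu
  have hanti := strictAntiOn_of_injOn_of_tendsto one_pos
    (continuousOn_of_exists_lipschitzOnWith hlip) hinj (tendsto_secantCos_zero hu)
    (hf.tendsto_secantCos_one hu) (by norm_num)
  have hae : ∀ᵐ w, w ∈ Ioo (0 : ℝ) 1 →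
      secantCos f (deriv f (u + w)) u w = secantCos f (deriv f u) u w ∧
      secantCosDeriv f u w * ‖f (u + w) - f u‖ = -(1 - secantCos f (deriv f u) u w ^ 2) := by
    filter_upwards [ae_add_left hf.ae_hasDerivAt u] with w hw' hw
    have hc := norm_pos_iff.2 (hf.sub_ne_zero u hw)
    have hd := hf.hasDerivAt_secantCos (u := u) hw hw'
    have hle : secantCosDeriv f u w ≤ 0 := by
      rw [← hd.deriv, ← derivWithin_of_mem_nhds (Ioo_mem_nhds hw.1 hw.2)]
      exact hanti.antitoneOn.derivWithin_nonpos
    have hlt := secantCos_sq_lt_one_of_circle hV hr (hmem u).1 (hmem u).2 hu.2 (hDV u)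
      (hperp u hu) (hmem (u + w)).1 (hmem (u + w)).2 (hne w hw)
    have h1 := secant_angles_of_circle hV hr (hmem u).1 (hmem u).2 hu.2 (hDV u)
      (hperp u hu) (hmem (u + w)).1 (hmem (u + w)).2 hw'.2 (hDV _) (hperp _ hw') (hne w hw)
    rw [← hsub, ← secantCos] at hlt h1
    rw [← secantCos] at h1
    rw [secantCosDeriv, div_mul_cancel₀ _ hc.ne']
    rcases h1 with ⟨h1, h2⟩ | h1
    · exact ⟨by rw [secantCos, h1, secantCos], h2⟩
    · have h3 : 0 < secantCosDeriv f u w := by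
        rw [secantCosDeriv, h1]
        exact div_pos (by linarith) hc
      exact absurd hle h3.not_ge
  refine hf.norm_add_sub_eq_sin hu (hf.hasDerivAt_secantCos_of_ae hu (hae.mono fun w h hw => ?_))
    (hae.mono fun w h hw => (h hw).1) hw
  rw [(h hw).2, sinOfCos_sq (abs_secantCos_le_one hu.2 u w)]

theorem lintegral_tpKernel_of_isCircle {q : ℝ} (hf : IsUnitSpeedLoop f) (hq : 1 < q)
    (hu : HasUnitDerivAt f u) (hcirc : IsCircle (range f)) :
    ∫⁻ v in Ioc (0 : ℝ) 1, tpKernel q f u v =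
      ENNReal.ofReal (π * ∫ w in (0 : ℝ)..1, sin (π * w) ^ (q - 1)) := by
  have hsin : ∀ w ∈ Ioo (0 : ℝ) 1, 0 < sin (π * w) := fun w hw =>
    sin_pos_of_pos_of_lt_pi (mul_pos pi_pos hw.1) (by nlinarith [pi_pos, hw.2])
  have hcont : Continuous fun w => π * sin (π * w) ^ (q - 1) :=
    continuous_const.mul (Continuous.rpow_const (by fun_prop) fun w => Or.inr (by linarith))
  rw [← setLIntegral_Ioc_add_of_periodic (tpKernel_periodic_right hf.periodic q u) u,
    ← setLIntegral_congr Ioo_ae_eq_Ioc, ← intervalIntegral.integral_const_mul,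
    intervalIntegral.integral_of_le zero_le_one, integral_Ioc_eq_integral_Ioo,
    ofReal_integral_eq_lintegral_ofReal]
  · refine setLIntegral_congr_fun measurableSet_Ioo fun w hw => ?_
    obtain ⟨h1, h2⟩ := hf.norm_add_sub_eq_sin_of_isCircle hu hcirc hw
    have hs := hsin w hw
    rw [tpKernel_add, h1, h2,
      sinOfCos_cos ⟨by nlinarith [pi_pos, hw.1], by nlinarith [pi_pos, hw.2]⟩, rpow_sub_one hs.ne']
    congr 1
    field_simp
  · exact hcont.integrableOn_Icc.mono_set Ioo_subset_Icc_self
  · filter_upwards [ae_restrict_mem measurableSet_Ioo] with w hw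
    have := hsin w hw
    positivity

theorem tpEnergy_of_isCircle {q : ℝ} (hf : IsUnitSpeedLoop f) (hq : 1 < q)
    (hcirc : IsCircle (range f)) :
    tpEnergy q f = ENNReal.ofReal (π * ∫ w in (0 : ℝ)..1, sin (π * w) ^ (q - 1)) := by
  rw [tpEnergy, lintegral_congr_ae (ae_restrict_of_ae (hf.ae_hasDerivAt.mono fun u hu =>
    hf.lintegral_tpKernel_of_isCircle hq hu hcirc))]
  simp

end IsUnitSpeedLoop

end CircleEnergy

namespace ClosedCurve

variable {n : ℕ} {γ : ClosedCurve n}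

theorem intervalIntegrable (γ : ClosedCurve n) (a b : ℝ) :
    IntervalIntegrable γ.deriv' volume a b := by
  refine γ.deriv'_periodic.intervalIntegrable₀ one_ne_zero ?_ a b
  rw [intervalIntegrable_iff_integrableOn_Icc_of_le zero_le_one]
  exact γ.integrableOn

theorem sub_eq_integral (γ : ClosedCurve n) (s t : ℝ) :
    γ.toFun t - γ.toFun s = ∫ x in s..t, γ.deriv' x := by
  rw [γ.eq_integral t, γ.eq_integral s, add_sub_add_left_eq_sub,
    integral_interval_sub_left (γ.intervalIntegrable _ _) (γ.intervalIntegrable _ _)]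

theorem ae_hasDerivAt (γ : ClosedCurve n) : ∀ᵐ t, HasDerivAt γ.toFun (γ.deriv' t) t := by
  have hloc : LocallyIntegrable γ.deriv' volume := fun x =>
    ⟨Icc (x - 1) (x + 1), Icc_mem_nhds (by linarith) (by linarith),
      (intervalIntegrable_iff_integrableOn_Icc_of_le (by linarith)).1 (γ.intervalIntegrable _ _)⟩
  filter_upwards [LocallyIntegrable.ae_hasDerivAt_integral hloc] with t ht
  rw [funext γ.eq_integral]
  exact (ht 0).const_add _

theorem isUnitSpeedLoop (hinj : γ.IsInj) (harc : γ.IsArclength) : IsUnitSpeedLoop γ.toFun where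
  lipschitz := by
    refine LipschitzWith.of_dist_le_mul fun t s => ?_
    rw [dist_eq_norm, γ.sub_eq_integral, NNReal.coe_one, dist_eq]
    exact norm_integral_le_of_norm_le_const_ae (harc.mono fun x hx _ => hx.le)
  periodic := γ.periodic
  ne u w hw h := by
    obtain ⟨k, hk⟩ := hinj _ _ h
    rw [add_sub_cancel_left] at hk
    rw [hk] at hw
    have h1 : 0 < k := by exact_mod_cast hw.1
    have h2 : k < 1 := by exact_mod_cast hw.2
    lia
  ae_hasDerivAt := by
    filter_upwards [γ.ae_hasDerivAt, harc] with t h1 h2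
    rw [HasUnitDerivAt, h1.deriv]
    exact ⟨h1, h2⟩

theorem TP_eq_tpEnergy (hinj : γ.IsInj) (harc : γ.IsArclength) (q : ℝ) :
    TP (q + 1) q γ = tpEnergy q γ.toFun := by
  have hf := isUnitSpeedLoop hinj harc
  refine lintegral_congr_ae (ae_restrict_of_ae ?_)
  filter_upwards [γ.ae_hasDerivAt, harc] with u hd hu
  rw [← setLIntegral_Ioc_add_of_periodic (tpKernel_periodic_right γ.periodic q u) u,
    ← setLIntegral_congr Ioo_ae_eq_Ioc, ← setLIntegral_congr Ioo_ae_eq_Ioc]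
  refine lintegral_congr_ae ?_
  filter_upwards [ae_restrict_mem measurableSet_Ioo, ae_restrict_of_ae (ae_add_left harc u)]
    with w hw hw'
  rw [hu, hw', mul_one, mul_one, norm_projPerp_rpow_div hu (hf.sub_ne_zero u hw), tpKernel,
    hd.deriv]

end ClosedCurve

end TangentPointLowerBound

/-- **The lower limit case `p = q+1`** (Theorem 5.11): for `q > 1` and arc-length
parametrized injective `γ`, `TP^{(q+1,q)}(γ) ≥ π ∫₀¹ sin(πw)^{q−1} dw`, with equality iff
the image of `γ` is a circle. -/
theorem tp_lower_limit_case {n : ℕ} (q : ℝ) (hq : 1 < q) (γ : ClosedCurve n)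
    (hinj : γ.IsInj) (harc : γ.IsArclength) :
    ENNReal.ofReal (π * ∫ w in (0:ℝ)..1, Real.sin (π * w) ^ (q - 1)) ≤ TP (q + 1) q γ ∧
    (TP (q + 1) q γ = ENNReal.ofReal (π * ∫ w in (0:ℝ)..1, Real.sin (π * w) ^ (q - 1)) ↔
      IsCircle (Set.range γ.toFun)) := by
  have hf := ClosedCurve.isUnitSpeedLoop hinj harc
  rw [ClosedCurve.TP_eq_tpEnergy hinj harc q]
  refine ⟨?_, fun h => ?_, hf.tpEnergy_of_isCircle hq⟩
  · rw [pi_mul_integral_sin_rpow]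
    exact hf.ofReal_integral_sin_rpow_le_tpEnergy hq
  · rw [pi_mul_integral_sin_rpow] at h
    exact isCircle_range_of_norm_add_sub_eq
      (hf.norm_add_sub_eq_abs_sin (hf.ae_isOptimalAt_of_tpEnergy_eq hq h))

end
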